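/- arXiv:2604.23738 — 4 statements merged into one kernel-verified Lean document; each statement's English description precedes it below -/
import Mathlib

section
/- There is an absolute constant C > 0 such that the following holds. Let G be a finite abelian group, let φ: G → G be a group automorphism, let r ≥ 1, and let χ: G → {1,…,r} be an r-colouring of G. Then the number of triples (x,y,z) ∈ G³ with χ(x) = χ(y) = χ(z) and φ(x) = y − z is at least exp(−r^C)·|G|². -/
namespace LengthWeight

open Finset

section

variable {G : Type*} [AddCommGroup G]

/-- A symmetric, subadditive, nonnegative function on an abelian group. -/
structure IsLength (p : G → ℝ) : Prop where
  nonneg : ∀ t, 0 ≤ p t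
  map_neg : ∀ t, p (-t) = p t
  map_add_le : ∀ s t, p (s + t) ≤ p s + p t

lemma IsLength.abs_sub_le {p : G → ℝ} (hp : IsLength p) (x t : G) :
    |p (x + t) - p x| ≤ p t := by
  have h1 := hp.map_add_le x t
  have h2 := hp.map_add_le (x + t) (-t)
  rw [hp.map_neg, add_neg_cancel_right] at h2
  rw [abs_le]
  constructor <;> linarith

lemma IsLength.comp {p : G → ℝ} (hp : IsLength p) (φ : G ≃+ G) :
    IsLength fun t => p (φ t) where
  nonneg t := hp.nonneg _
  map_neg t := by rw [_root_.map_neg, hp.map_neg]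
  map_add_le s t := by rw [map_add]; exact hp.map_add_le _ _

variable [Fintype G]

/-- The total mass of `t ↦ exp (-K p(t))`. -/
noncomputable def mass (p : G → ℝ) (K : ℝ) : ℝ := ∑ t, Real.exp (-(K * p t))

/-- The probability measure on `G` proportional to `exp (-K p(t))`: a smooth substitute for the
uniform measure on the ball of radius `1 / K` around the origin. -/
noncomputable def weight (p : G → ℝ) (K : ℝ) (t : G) : ℝ := Real.exp (-(K * p t)) / mass p K

/-- The largest average of `f` over a translate of `weight p K`. -/
noncomputable def dens (p : G → ℝ) (K : ℝ) (f : G → ℝ) : ℝ :=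
  ⨆ x, ∑ t, weight p K t * f (x + t)

lemma mass_pos (p : G → ℝ) (K : ℝ) : 0 < mass p K :=
  sum_pos (fun _ _ => Real.exp_pos _) univ_nonempty

lemma weight_nonneg (p : G → ℝ) (K : ℝ) (t : G) : 0 ≤ weight p K t :=
  div_nonneg (Real.exp_pos _).le (mass_pos p K).le

lemma sum_weight (p : G → ℝ) (K : ℝ) : ∑ t, weight p K t = 1 := by
  simp only [weight, ← sum_div]
  exact div_self (mass_pos p K).ne'

lemma weight_le {p : G → ℝ} (hp : IsLength p) {K : ℝ} (hK : 0 ≤ K) (t : G) :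
    weight p K t ≤ 1 / mass p K := by
  have : 0 ≤ K * p t := mul_nonneg hK (hp.nonneg t)
  unfold weight
  gcongr
  · exact (mass_pos p K).le
  · exact Real.exp_le_one_iff.2 (by linarith)

lemma sum_add_right (f : G → ℝ) (t : G) : ∑ x, f (x + t) = ∑ x, f x :=
  Equiv.sum_comp (Equiv.addRight t) f

lemma le_dens (p : G → ℝ) (K : ℝ) (f : G → ℝ) (x : G) :
    ∑ t, weight p K t * f (x + t) ≤ dens p K f :=
  le_ciSup (f := fun x => ∑ t, weight p K t * f (x + t)) (Set.finite_range _).bddAbove x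

lemma exists_eq_dens (p : G → ℝ) (K : ℝ) (f : G → ℝ) :
    ∃ x, ∑ t, weight p K t * f (x + t) = dens p K f :=
  exists_eq_ciSup_of_finite

lemma dens_nonneg (p : G → ℝ) (K : ℝ) {f : G → ℝ} (hf : ∀ x, 0 ≤ f x) : 0 ≤ dens p K f :=
  (sum_nonneg fun t _ => mul_nonneg (weight_nonneg p K t) (hf _)).trans (le_dens p K f 0)

lemma sum_weight_mul_le (p : G → ℝ) (K : ℝ) {f : G → ℝ} {M : ℝ} (hf : ∀ x, f x ≤ M) :
    ∑ t, weight p K t * f t ≤ M := by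
  calc ∑ t, weight p K t * f t ≤ ∑ t, weight p K t * M :=
        sum_le_sum fun t _ => mul_le_mul_of_nonneg_left (hf _) (weight_nonneg p K t)
    _ = M := by rw [← sum_mul, sum_weight, one_mul]

lemma dens_le_one (p : G → ℝ) (K : ℝ) {f : G → ℝ} (hf : ∀ x, f x ≤ 1) : dens p K f ≤ 1 :=
  ciSup_le fun x => sum_weight_mul_le p K (f := fun t => f (x + t)) fun _ => hf _

lemma abs_exp_neg_sub_le (a b : ℝ) :
    |Real.exp (-a) - Real.exp (-b)| ≤ |a - b| * (Real.exp (-a) + Real.exp (-b)) := by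
  have key : ∀ a b : ℝ, Real.exp (-a) - Real.exp (-b) ≤
      |a - b| * (Real.exp (-a) + Real.exp (-b)) := fun a b => by
    have h1 := Real.add_one_le_exp (a - b)
    have h2 : Real.exp (-b) = Real.exp (-a) * Real.exp (a - b) := by
      rw [← Real.exp_add]; congr 1; ring
    have h3 := Real.exp_pos (-a)
    have h4 := Real.exp_pos (-b)
    have h5 := neg_abs_le (a - b)
    have h6 := abs_nonneg (a - b)
    have h7 : Real.exp (-a) * (1 - |a - b|) ≤ Real.exp (-b) := by
      rw [h2]; gcongr; linarith
    nlinarith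
  rw [abs_le]
  have h1 := key a b
  have h2 := key b a
  rw [abs_sub_comm] at h2
  constructor <;> linarith

lemma sum_abs_weight_sub_le {p : G → ℝ} (hp : IsLength p) {K : ℝ} (hK : 0 ≤ K) (t : G) :
    ∑ x, |weight p K (x + t) - weight p K x| ≤ 2 * (K * p t) := by
  have hZ := mass_pos p K
  have hpt : ∀ x, |weight p K (x + t) - weight p K x| ≤
      K * p t * (weight p K (x + t) + weight p K x) := fun x => by
    have h := abs_exp_neg_sub_le (K * p (x + t)) (K * p x)
    have h1 : |K * p (x + t) - K * p x| ≤ K * p t := by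
      rw [← mul_sub, abs_mul, abs_of_nonneg hK]
      exact mul_le_mul_of_nonneg_left (hp.abs_sub_le x t) hK
    unfold weight
    rw [← sub_div, ← add_div, abs_div, abs_of_pos hZ, ← mul_div_assoc]
    gcongr
    exact h.trans (by gcongr)
  calc _ ≤ ∑ x, K * p t * (weight p K (x + t) + weight p K x) := sum_le_sum fun x _ => hpt x
    _ = 2 * (K * p t) := by
      rw [← mul_sum, sum_add_distrib, sum_add_right (weight p K), sum_weight]; ring

/-- Averages of a bounded function over `weight p K` are nearly invariant under short
translations. -/
lemma sum_weight_mul_le_translate {p : G → ℝ} (hp : IsLength p) {K : ℝ} (hK : 0 ≤ K) {f : G → ℝ}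
    (hf : ∀ x, 0 ≤ f x) (hf1 : ∀ x, f x ≤ 1) (t : G) :
    ∑ x, weight p K x * f x ≤ ∑ x, weight p K x * f (x + t) + 2 * (K * p t) := by
  rw [← sum_add_right (fun x => weight p K x * f x) t]
  have h := sum_abs_weight_sub_le hp hK t
  have : ∑ x, weight p K (x + t) * f (x + t) ≤
      ∑ x, (weight p K x * f (x + t) + |weight p K (x + t) - weight p K x|) := by
    refine sum_le_sum fun x _ => ?_
    have h1 := le_abs_self (weight p K (x + t) - weight p K x)
    have h2 := abs_nonneg (weight p K (x + t) - weight p K x)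
    nlinarith [hf (x + t), hf1 (x + t)]
  rw [sum_add_distrib] at this
  linarith

lemma mul_exp_neg_le {x D : ℝ} (hx : 0 ≤ x) (hD : 0 ≤ D) :
    x * Real.exp (-x) ≤ 2 * D * Real.exp (-x) + Real.exp (-D) := by
  rcases le_total x (2 * D) with h | h
  · have := Real.exp_pos (-x)
    have := Real.exp_pos (-D)
    nlinarith
  · have h1 : x ≤ Real.exp (x / 2) := by
      have := Real.quadratic_le_exp_of_nonneg (x := x / 2) (by linarith)
      nlinarith [sq_nonneg (x / 2 - 1)]
    have h2 : x * Real.exp (-x) ≤ Real.exp (x / 2) * Real.exp (-x) := by gcongr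
    rw [← Real.exp_add] at h2
    have h3 : Real.exp (x / 2 + -x) ≤ Real.exp (-D) := Real.exp_le_exp.2 (by linarith)
    have : 0 ≤ 2 * D * Real.exp (-x) := by positivity
    linarith

/-- The mean length under `weight p K` is `O(D / K)` if the mass is at least `exp (-D) |G|`. -/
lemma sum_weight_mul_length_le {p : G → ℝ} (hp : IsLength p) {K D : ℝ} (hK : 0 < K) (hD : 0 ≤ D)
    (hZ : Real.exp (-D) * Fintype.card G ≤ mass p K) :
    ∑ t, weight p K t * p t ≤ (2 * D + 1) / K := by
  have hm := mass_pos p K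
  have h : ∑ t, K * p t * Real.exp (-(K * p t)) ≤ (2 * D + 1) * mass p K := by
    calc _ ≤ ∑ t, (2 * D * Real.exp (-(K * p t)) + Real.exp (-D)) :=
          sum_le_sum fun t _ => mul_exp_neg_le (mul_nonneg hK.le (hp.nonneg t)) hD
      _ = 2 * D * mass p K + Real.exp (-D) * Fintype.card G := by
          rw [sum_add_distrib, ← mul_sum, sum_const, card_univ, nsmul_eq_mul, mul_comm (Real.exp _)]
          rfl
      _ ≤ _ := by linarith
  have h2 : ∑ t, weight p K t * p t =
      (∑ t, K * p t * Real.exp (-(K * p t))) / (K * mass p K) := by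
    rw [sum_div]
    refine sum_congr rfl fun t _ => ?_
    unfold weight
    field_simp
  rw [h2, div_le_div_iff₀ (by positivity) hK]
  nlinarith

/-- Passing to a longer length at a finer scale hardly decreases the density. -/
lemma sum_weight_mul_le_dens {p p' : G → ℝ} (hp : IsLength p) (hp' : IsLength p')
    (hle : ∀ t, p t ≤ p' t) {K K' D : ℝ} (hK : 0 ≤ K) (hK' : 0 < K') (hD : 0 ≤ D)
    (hZ : Real.exp (-D) * Fintype.card G ≤ mass p' K') {f : G → ℝ}
    (hf : ∀ x, 0 ≤ f x) (hf1 : ∀ x, f x ≤ 1) (x₀ : G) :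
    ∑ x, weight p K x * f (x₀ + x) ≤ dens p' K' f + 2 * K * ((2 * D + 1) / K') := by
  set m := ∑ x, weight p K x * f (x₀ + x)
  have h1 : m ≤ ∑ t, weight p' K' t *
      (∑ x, weight p K x * f (x₀ + (x + t)) + 2 * (K * p' t)) := by
    calc m = ∑ t, weight p' K' t * m := by rw [← sum_mul, sum_weight, one_mul]
      _ ≤ _ := by
        refine sum_le_sum fun t _ => mul_le_mul_of_nonneg_left ?_ (weight_nonneg _ _ _)
        have := sum_weight_mul_le_translate hp hK (f := fun x => f (x₀ + x))
          (fun x => hf _) (fun x => hf1 _) t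
        have h3 : K * p t ≤ K * p' t := mul_le_mul_of_nonneg_left (hle t) hK
        linarith
  have h2 : ∑ t, weight p' K' t * (∑ x, weight p K x * f (x₀ + (x + t)) + 2 * (K * p' t)) =
      ∑ x, weight p K x * (∑ t, weight p' K' t * f (x₀ + x + t)) +
        2 * K * ∑ t, weight p' K' t * p' t := by
    simp only [mul_add, sum_add_distrib, mul_sum]
    congr 1
    · rw [sum_comm]
      refine sum_congr rfl fun x _ => sum_congr rfl fun t _ => ?_
      rw [add_assoc]; ring
    · exact sum_congr rfl fun t _ => by ring
  have h3 : ∑ x, weight p K x * (∑ t, weight p' K' t * f (x₀ + x + t)) ≤ dens p' K' f :=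
    sum_weight_mul_le p K (f := fun x => ∑ t, weight p' K' t * f (x₀ + x + t))
      fun x => le_dens p' K' f _
  have h4 := sum_weight_mul_length_le hp' hK' hD hZ
  have h5 : 2 * K * ∑ t, weight p' K' t * p' t ≤ 2 * K * ((2 * D + 1) / K') := by gcongr
  linarith

/-- Pigeonhole bound for the mass of a length controlled by bounded complex functions. -/
lemma card_le_mul_mass {ι : Type*} (s : Finset ι) (g : ι → G → ℂ) (hg : ∀ i x, ‖g i x‖ ≤ 1)
    {p : G → ℝ} (hp : ∀ x y, p (x - y) ≤ ∑ i ∈ s, ‖g i x - g i y‖) {K : ℕ} (hK : 1 ≤ K) :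
    (Fintype.card G : ℝ) ≤ Real.exp (2 * s.card) * (2 * K + 1) ^ (2 * s.card) * mass p K := by
  classical
  have hK0 : (0 : ℝ) < K := by exact_mod_cast hK
  let cell : G → (s → ℤ × ℤ) := fun x i => (⌊K * (g i x).re⌋, ⌊K * (g i x).im⌋)
  let cells : Finset (s → ℤ × ℤ) := Fintype.piFinset fun _ => Icc (-K : ℤ) K ×ˢ Icc (-K : ℤ) K
  have hmem : ∀ x, cell x ∈ cells := by
    intro x
    have hfl : ∀ a : ℝ, |a| ≤ 1 → ⌊K * a⌋ ∈ Icc (-K : ℤ) K := by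
      intro a ha
      rw [abs_le] at ha
      rw [mem_Icc]
      constructor
      · rw [Int.le_floor]; push_cast; nlinarith
      · have : (⌊K * a⌋ : ℝ) ≤ K := (Int.floor_le _).trans (by nlinarith)
        exact_mod_cast this
    simp only [cells, Fintype.mem_piFinset, mem_product, cell]
    exact fun i => ⟨hfl _ ((Complex.abs_re_le_norm _).trans (hg _ _)),
      hfl _ ((Complex.abs_im_le_norm _).trans (hg _ _))⟩
  have hcells : (cells.card : ℝ) = (2 * K + 1) ^ (2 * s.card) := by
    have h1 : (Icc (-K : ℤ) K).card = 2 * K + 1 := by rw [Int.card_Icc]; omega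
    have : cells.card = (2 * K + 1) ^ (2 * s.card) := by
      simp only [cells, Fintype.card_piFinset, card_product, h1, prod_const, card_univ,
        Fintype.card_coe]
      rw [← pow_two, ← pow_mul]
    rw [this]; push_cast; rfl
  have hfib : ∀ c ∈ cells, ((univ.filter fun x => cell x = c).card : ℝ) ≤
      Real.exp (2 * s.card) * mass p K := by
    intro c _
    rcases (univ.filter fun x => cell x = c).eq_empty_or_nonempty with h | ⟨y, hy⟩
    · rw [h, card_empty, Nat.cast_zero]
      have := mass_pos p K
      positivity
    · rw [mem_filter] at hy
      have hclose : ∀ x, cell x = c → K * p (x - y) ≤ 2 * s.card := by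
        intro x hx
        have hi : ∀ i ∈ s, ‖g i x - g i y‖ ≤ 2 / K := by
          intro i hi
          have hxy : cell x ⟨i, hi⟩ = cell y ⟨i, hi⟩ := by rw [hx, hy.2]
          simp only [cell, Prod.mk.injEq] at hxy
          have hd : ∀ a b : ℝ, ⌊K * a⌋ = ⌊K * b⌋ → |a - b| ≤ 1 / K := by
            intro a b hab
            have := Int.abs_sub_lt_one_of_floor_eq_floor hab
            rw [← mul_sub, abs_mul, abs_of_pos hK0] at this
            rw [le_div_iff₀ hK0]; linarith
          have h1 := hd _ _ hxy.1
          have h2 := hd _ _ hxy.2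
          have h3 := Complex.norm_le_abs_re_add_abs_im (g i x - g i y)
          rw [Complex.sub_re, Complex.sub_im] at h3
          calc _ ≤ _ := h3
            _ ≤ 1 / K + 1 / K := by linarith
            _ = 2 / K := by ring
        calc K * p (x - y) ≤ K * ∑ i ∈ s, (2 / K : ℝ) := by
              gcongr; exact (hp x y).trans (sum_le_sum hi)
          _ = 2 * s.card := by rw [sum_const, nsmul_eq_mul]; field_simp
      have h1 : ((univ.filter fun x => cell x = c).card : ℝ) * Real.exp (-(2 * s.card)) ≤
          mass p K := by
        calc _ = ∑ x ∈ univ.filter (fun x => cell x = c), Real.exp (-(2 * s.card)) := by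
              rw [sum_const, nsmul_eq_mul]
          _ ≤ ∑ x ∈ univ.filter (fun x => cell x = c), Real.exp (-(K * p (x - y))) := by
              refine sum_le_sum fun x hx => Real.exp_le_exp.2 ?_
              have := hclose x (mem_filter.1 hx).2
              linarith
          _ ≤ ∑ x, Real.exp (-(K * p (x - y))) :=
              sum_le_sum_of_subset_of_nonneg (filter_subset _ _) fun _ _ _ => (Real.exp_pos _).le
          _ = mass p K := Equiv.sum_comp (Equiv.subRight y) fun x => Real.exp (-(K * p x))
      rw [Real.exp_neg, ← div_eq_mul_inv, div_le_iff₀ (Real.exp_pos _)] at h1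
      linarith
  have h1 : (Fintype.card G : ℝ) = ∑ c ∈ cells, ((univ.filter fun x => cell x = c).card : ℝ) := by
    rw [← card_univ, card_eq_sum_card_fiberwise (fun x _ => hmem x)]
    push_cast; rfl
  calc (Fintype.card G : ℝ) ≤ ∑ c ∈ cells, Real.exp (2 * s.card) * mass p K := by
        rw [h1]; exact sum_le_sum hfib
    _ = _ := by rw [sum_const, nsmul_eq_mul, hcells]; ring

end

section

variable {G : Type*} [AddCommGroup G] [Fintype G]

open ComplexConjugate

/-- Plancherel's identity. -/
lemma sum_norm_sq_fourier (c : G → ℂ) :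
    ∑ ψ : AddChar G ℂ, ‖∑ x, c x * ψ x‖ ^ 2 = Fintype.card G * ∑ x, ‖c x‖ ^ 2 := by
  classical
  have key : ((∑ ψ : AddChar G ℂ, ‖∑ x, c x * ψ x‖ ^ 2 : ℝ) : ℂ) =
      ((Fintype.card G * ∑ x, ‖c x‖ ^ 2 : ℝ) : ℂ) := by
    push_cast
    simp only [← Complex.mul_conj', map_sum, map_mul, sum_mul_sum]
    rw [sum_comm, mul_sum]
    refine sum_congr rfl fun x _ => ?_
    rw [sum_comm, sum_eq_single x]
    · have : ∀ ψ : AddChar G ℂ, c x * ψ x * (conj (c x) * conj (ψ x)) = c x * conj (c x) := by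
        intro ψ
        have h : ψ x * conj (ψ x) = 1 := by
          rw [← AddChar.map_neg_eq_conj, ← AddChar.map_add_eq_mul, add_neg_cancel,
            AddChar.map_zero_eq_one]
        calc _ = c x * conj (c x) * (ψ x * conj (ψ x)) := by ring
          _ = _ := by rw [h, mul_one]
      simp only [this, sum_const, card_univ, nsmul_eq_mul, AddChar.card_eq]
    · intro y _ hy
      have : ∀ ψ : AddChar G ℂ, c x * ψ x * (conj (c y) * conj (ψ y)) =
          c x * conj (c y) * ψ (x - y) := by
        intro ψ
        rw [← AddChar.map_neg_eq_conj, sub_eq_add_neg, AddChar.map_add_eq_mul]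
        ring
      simp only [this, ← mul_sum]
      rw [AddChar.sum_apply_eq_zero_iff_ne_zero.2 (sub_ne_zero.2 hy.symm), mul_zero]
    · simp
  exact_mod_cast key

lemma sum_translate_mul_char (b : G → ℂ) (ψ : AddChar G ℂ) (s : G) :
    ∑ x, b (x + s) * ψ x = ψ (-s) * ∑ x, b x * ψ x := by
  rw [← Equiv.sum_comp (Equiv.addRight s) fun x => b x * ψ x, mul_sum]
  refine sum_congr rfl fun x _ => ?_
  have h : ψ (-s) * ψ s = 1 := by
    rw [← AddChar.map_add_eq_mul, neg_add_cancel, AddChar.map_zero_eq_one]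
  simp only [Equiv.coe_addRight, AddChar.map_add_eq_mul]
  linear_combination (-(b (x + s) * ψ x)) * h

/-- Replacing `b` by its average `b * ν` changes a correlation against `e` little, provided `ν`
has Fourier transform near `1` wherever that of `e` is large. -/
lemma abs_correlation_sub_le {a b e ν : G → ℝ} {M : ℝ} (hM : 0 ≤ M)
    (ha : ∑ x, a x ^ 2 ≤ 1) (hb : ∑ x, b x ^ 2 ≤ 1)
    (h : ∀ ψ : AddChar G ℂ, ‖∑ s, (e s : ℂ) * ψ s‖ * ‖1 - ∑ t, (ν t : ℂ) * ψ t‖ ≤ M) :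
    |∑ x, a x * ∑ s, e s * (b (x + s) - ∑ t, ν t * b (x + s + t))| ≤ M := by
  set c : G → ℝ := fun x => ∑ s, e s * (b (x + s) - ∑ t, ν t * b (x + s + t)) with hc
  have hhat : ∀ ψ : AddChar G ℂ, ∑ x, (c x : ℂ) * ψ x =
      (∑ s, (e s : ℂ) * (-ψ) s) * (1 - ∑ t, (ν t : ℂ) * (-ψ) t) * ∑ x, (b x : ℂ) * ψ x := by
    intro ψ
    have hT := sum_translate_mul_char (fun x => (b x : ℂ)) ψ
    generalize ∑ x, (b x : ℂ) * ψ x = B at hT ⊢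
    have h1 : ∀ s, ∑ x, ((b (x + s) - ∑ t, ν t * b (x + s + t) : ℝ) : ℂ) * ψ x =
        ψ (-s) * (1 - ∑ t, (ν t : ℂ) * ψ (-t)) * B := by
      intro s
      push_cast
      simp only [sub_mul, sum_sub_distrib, sum_mul]
      rw [hT, mul_sub, sub_mul, mul_one]
      congr 1
      rw [sum_comm, mul_sum, sum_mul]
      refine sum_congr rfl fun t _ => ?_
      have := hT (s + t)
      simp only [← add_assoc] at this
      simp only [mul_assoc]
      rw [← mul_sum, this, neg_add, AddChar.map_add_eq_mul]
      ring
    simp only [hc, Complex.ofReal_sum, Complex.ofReal_mul, sum_mul, AddChar.neg_apply]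
    rw [sum_comm]
    refine sum_congr rfl fun s _ => ?_
    simp only [mul_assoc]
    rw [← mul_sum, h1]
    ring
  have hcb : ∑ x, c x ^ 2 ≤ M ^ 2 := by
    have hP := sum_norm_sq_fourier fun x => (c x : ℂ)
    have hPb := sum_norm_sq_fourier fun x => (b x : ℂ)
    simp only [Complex.norm_real, Real.norm_eq_abs, sq_abs] at hP hPb
    have hle : ∑ ψ : AddChar G ℂ, ‖∑ x, (c x : ℂ) * ψ x‖ ^ 2 ≤
        M ^ 2 * ∑ ψ : AddChar G ℂ, ‖∑ x, (b x : ℂ) * ψ x‖ ^ 2 := by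
      rw [mul_sum]
      refine sum_le_sum fun ψ _ => ?_
      rw [hhat, norm_mul, norm_mul, mul_pow]
      gcongr
      exact h (-ψ)
    rw [hP, hPb] at hle
    have hG : (0 : ℝ) < Fintype.card G := by exact_mod_cast Fintype.card_pos
    have h2 : (Fintype.card G : ℝ) * ∑ x, c x ^ 2 ≤ Fintype.card G * M ^ 2 := by
      refine hle.trans ?_
      have : M ^ 2 * (Fintype.card G * ∑ x, b x ^ 2) ≤ M ^ 2 * (Fintype.card G * 1) := by gcongr
      linarith
    exact le_of_mul_le_mul_left h2 hG
  refine abs_le_of_sq_le_sq ?_ hM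
  calc _ ≤ (∑ x, a x ^ 2) * ∑ x, c x ^ 2 := sum_mul_sq_le_sq_mul_sq _ _ _
    _ ≤ 1 * M ^ 2 := by gcongr
    _ = M ^ 2 := one_mul _

/-- Bessel's inequality for characters that are almost orthogonal for a probability measure. -/
lemma card_mul_le_one_of_almost_orthogonal {β : G → ℝ} (hβ : ∀ s, 0 ≤ β s) (hβ1 : ∑ s, β s = 1)
    (E : Finset G) {η θ : ℝ} (hη : 0 ≤ η) (hE : 0 < ∑ s ∈ E, β s) (Λ : Finset (AddChar G ℂ))
    (hΛ : ∀ ψ ∈ Λ, η * ∑ s ∈ E, β s ≤ ‖∑ s ∈ E, (β s : ℂ) * ψ s‖)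
    (horth : ∀ ψ ∈ Λ, ∀ ψ' ∈ Λ, ψ ≠ ψ' → ‖∑ s, (β s : ℂ) * (ψ - ψ') s‖ ≤ θ) (hθ : 0 ≤ θ) :
    Λ.card * (η ^ 2 * ∑ s ∈ E, β s) ≤ 1 + Λ.card * θ := by
  classical
  set ε := ∑ s ∈ E, β s
  let c : AddChar G ℂ → ℂ := fun ψ =>
    conj (∑ s ∈ E, (β s : ℂ) * ψ s) / ‖∑ s ∈ E, (β s : ℂ) * ψ s‖
  have hc1 : ∀ ψ, ‖c ψ‖ ≤ 1 := fun ψ => by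
    simp only [c, norm_div, RCLike.norm_conj, Complex.norm_real, norm_norm]
    exact div_self_le_one _
  have hc : ∀ ψ, c ψ * ∑ s ∈ E, (β s : ℂ) * ψ s = ‖∑ s ∈ E, (β s : ℂ) * ψ s‖ := fun ψ => by
    simp only [c]
    rw [div_mul_eq_mul_div, Complex.conj_mul', pow_two, mul_self_div_self]
  let F : G → ℂ := fun s => ∑ ψ ∈ Λ, c ψ * ψ s
  have h1 : Λ.card * (η * ε) ≤ ∑ s ∈ E, β s * ‖F s‖ := by
    have e1 : ((∑ ψ ∈ Λ, ‖∑ s ∈ E, (β s : ℂ) * ψ s‖ : ℝ) : ℂ) = ∑ s ∈ E, (β s : ℂ) * F s := by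
      push_cast
      simp only [← hc, F, mul_sum]
      rw [sum_comm]
      exact sum_congr rfl fun s _ => sum_congr rfl fun ψ _ => by ring
    calc Λ.card * (η * ε) = ∑ ψ ∈ Λ, η * ε := by rw [sum_const, nsmul_eq_mul]
      _ ≤ ∑ ψ ∈ Λ, ‖∑ s ∈ E, (β s : ℂ) * ψ s‖ := sum_le_sum hΛ
      _ ≤ ‖((∑ ψ ∈ Λ, ‖∑ s ∈ E, (β s : ℂ) * ψ s‖ : ℝ) : ℂ)‖ := by
        rw [Complex.norm_real]; exact Real.le_norm_self _
      _ ≤ ∑ s ∈ E, β s * ‖F s‖ := by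
        rw [e1]
        refine (norm_sum_le _ _).trans_eq (sum_congr rfl fun s _ => ?_)
        rw [norm_mul, Complex.norm_real, Real.norm_of_nonneg (hβ s)]
  have h2 : (∑ s ∈ E, β s * ‖F s‖) ^ 2 ≤ ε * ∑ s, β s * ‖F s‖ ^ 2 := by
    calc (∑ s ∈ E, β s * ‖F s‖) ^ 2 = (∑ s ∈ E, √(β s) * (√(β s) * ‖F s‖)) ^ 2 := by
          congr 1
          exact sum_congr rfl fun s _ => by rw [← mul_assoc, Real.mul_self_sqrt (hβ s)]
      _ ≤ (∑ s ∈ E, √(β s) ^ 2) * ∑ s ∈ E, (√(β s) * ‖F s‖) ^ 2 :=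
          sum_mul_sq_le_sq_mul_sq _ _ _
      _ = ε * ∑ s ∈ E, β s * ‖F s‖ ^ 2 := by simp only [mul_pow, Real.sq_sqrt (hβ _), ε]
      _ ≤ ε * ∑ s, β s * ‖F s‖ ^ 2 := by
          refine mul_le_mul_of_nonneg_left ?_ hE.le
          exact sum_le_sum_of_subset_of_nonneg (subset_univ _)
            fun s _ _ => mul_nonneg (hβ s) (sq_nonneg _)
  have h3 : ∑ s, β s * ‖F s‖ ^ 2 ≤ Λ.card + Λ.card * (Λ.card * θ) := by
    have e2 : ((∑ s, β s * ‖F s‖ ^ 2 : ℝ) : ℂ) =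
        ∑ ψ ∈ Λ, ∑ ψ' ∈ Λ, c ψ * conj (c ψ') * ∑ s, (β s : ℂ) * (ψ - ψ') s := by
      push_cast
      have hF : ∀ s, (‖F s‖ : ℂ) ^ 2 =
          ∑ ψ ∈ Λ, ∑ ψ' ∈ Λ, c ψ * ψ s * (conj (c ψ') * conj (ψ' s)) := fun s => by
        simp only [← Complex.mul_conj', F, map_sum, map_mul, sum_mul_sum]
      simp only [hF, mul_sum]
      rw [sum_comm]
      refine sum_congr rfl fun ψ _ => ?_
      rw [sum_comm]
      refine sum_congr rfl fun ψ' _ => sum_congr rfl fun s _ => ?_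
      rw [AddChar.sub_apply, AddChar.map_neg_eq_conj]
      ring
    calc ∑ s, β s * ‖F s‖ ^ 2 ≤ ‖((∑ s, β s * ‖F s‖ ^ 2 : ℝ) : ℂ)‖ := by
          rw [Complex.norm_real]; exact Real.le_norm_self _
      _ ≤ ∑ ψ ∈ Λ, ∑ ψ' ∈ Λ, ((if ψ = ψ' then 1 else 0) + θ) := by
          rw [e2]
          refine (norm_sum_le _ _).trans (sum_le_sum fun ψ hψ => (norm_sum_le _ _).trans
            (sum_le_sum fun ψ' hψ' => ?_))
          rw [norm_mul, norm_mul, RCLike.norm_conj]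
          have hcc : ‖c ψ‖ * ‖c ψ'‖ ≤ 1 := mul_le_one₀ (hc1 _) (norm_nonneg _) (hc1 _)
          refine (mul_le_of_le_one_left (norm_nonneg _) hcc).trans ?_
          split_ifs with heq
          · have : ‖∑ s, (β s : ℂ) * (ψ - ψ') s‖ ≤ 1 := by
              subst heq
              simp only [sub_self, AddChar.zero_apply, mul_one, ← Complex.ofReal_sum, hβ1]
              simp
            linarith
          · rw [zero_add]; exact horth ψ hψ ψ' hψ' heq
      _ = Λ.card + Λ.card * (Λ.card * θ) := by
          simp only [sum_add_distrib, sum_ite_eq, sum_const, nsmul_eq_mul]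
          congr 1
          rw [sum_ite_mem, inter_self, sum_const, nsmul_eq_mul, mul_one]
  rcases Λ.eq_empty_or_nonempty with rfl | hne
  · simp
  have hn : (0 : ℝ) < Λ.card := by exact_mod_cast hne.card_pos
  have h4 : (Λ.card * (η * ε)) ^ 2 ≤ ε * (Λ.card + Λ.card * (Λ.card * θ)) :=
    calc _ ≤ (∑ s ∈ E, β s * ‖F s‖) ^ 2 := by gcongr
      _ ≤ _ := h2.trans (by gcongr)
  have h5 : ε * Λ.card * (Λ.card * (η ^ 2 * ε)) ≤ ε * Λ.card * (1 + Λ.card * θ) := by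
    linarith
  exact le_of_mul_le_mul_left h5 (by positivity)

/-- A character with a large Fourier coefficient for `weight p K` is Lipschitz for `p`. -/
lemma norm_one_sub_mul_le {p : G → ℝ} (hp : IsLength p) {K : ℝ} (hK : 0 ≤ K)
    (ψ : AddChar G ℂ) (t : G) :
    ‖1 - ψ t‖ * ‖∑ s, (weight p K s : ℂ) * ψ s‖ ≤ 2 * (K * p t) := by
  have h : (1 - ψ t) * ∑ s, (weight p K s : ℂ) * ψ s =
      ∑ s, ((weight p K (s + t) - weight p K s : ℝ) : ℂ) * ψ (s + t) := by
    have h1 := Equiv.sum_comp (Equiv.addRight t) fun s => (weight p K s : ℂ) * ψ s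
    simp only [Equiv.coe_addRight] at h1
    push_cast
    simp only [sub_mul, sum_sub_distrib, one_mul, AddChar.map_add_eq_mul] at *
    rw [h1, mul_sum]
    congr 1
    exact sum_congr rfl fun s _ => by ring
  rw [← norm_mul, h]
  refine (norm_sum_le _ _).trans ((sum_le_sum fun s _ => ?_).trans
    (sum_abs_weight_sub_le hp hK t))
  rw [norm_mul, AddChar.norm_apply, mul_one, Complex.norm_real, Real.norm_eq_abs]

/-- The large spectrum of a subset is controlled, at the scale of `p`, by few characters. -/
lemma exists_spectrum_cover {p : G → ℝ} (hp : IsLength p) {K : ℝ} (hK : 0 ≤ K)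
    (E : Finset G) {ε η : ℝ} (hε : 0 < ε) (hη : 0 < η) (hE : ε ≤ ∑ s ∈ E, weight p K s) :
    ∃ Λ : Finset (AddChar G ℂ), (Λ.card : ℝ) ≤ 2 / (η ^ 2 * ε) ∧
      ∀ ψ : AddChar G ℂ, η * ∑ s ∈ E, weight p K s ≤ ‖∑ s ∈ E, (weight p K s : ℂ) * ψ s‖ →
        ∃ ψ' ∈ Λ, ∀ t, ‖1 - ψ t‖ ≤ ‖1 - ψ' t‖ + 4 * K / (η ^ 2 * ε) * p t := by
  classical
  set θ := η ^ 2 * ε / 2 with hθ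
  have hθ0 : 0 < θ := by positivity
  let good : Finset (AddChar G ℂ) → Prop := fun Λ =>
    (∀ ψ ∈ Λ, η * ∑ s ∈ E, weight p K s ≤ ‖∑ s ∈ E, (weight p K s : ℂ) * ψ s‖) ∧
    ∀ ψ ∈ Λ, ∀ ψ' ∈ Λ, ψ ≠ ψ' → ‖∑ s, (weight p K s : ℂ) * (ψ - ψ') s‖ ≤ θ
  obtain ⟨Λ, hΛ, hmax⟩ := exists_max_image (univ.filter good) card
    ⟨∅, mem_filter.2 ⟨mem_univ _, by simp [good]⟩⟩
  have hgood : good Λ := (mem_filter.1 hΛ).2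
  have hbessel := card_mul_le_one_of_almost_orthogonal (weight_nonneg p K) (sum_weight p K) E hη.le
    (hε.trans_le hE) Λ hgood.1 hgood.2 hθ0.le
  refine ⟨Λ, ?_, fun ψ hψ => ?_⟩
  · rw [le_div_iff₀ (by positivity)]
    have : (Λ.card : ℝ) * (η ^ 2 * ε) ≤ Λ.card * (η ^ 2 * ∑ s ∈ E, weight p K s) := by gcongr
    have h2 : (Λ.card : ℝ) * θ = Λ.card * (η ^ 2 * ε) / 2 := by rw [hθ]; ring
    linarith
  · by_cases hmem : ψ ∈ Λ
    · refine ⟨ψ, hmem, fun t => ?_⟩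
      have := hp.nonneg t
      have : 0 ≤ 4 * K / (η ^ 2 * ε) * p t := by positivity
      linarith
    · have hbig : ∃ ψ' ∈ Λ, θ < ‖∑ s, (weight p K s : ℂ) * (ψ - ψ') s‖ := by
        by_contra! hcon
        have hsymm : ∀ ψ₁ ψ₂ : AddChar G ℂ, ‖∑ s, (weight p K s : ℂ) * (ψ₁ - ψ₂) s‖ =
            ‖∑ s, (weight p K s : ℂ) * (ψ₂ - ψ₁) s‖ := by
          intro ψ₁ ψ₂
          rw [← RCLike.norm_conj, map_sum]
          congr 1
          refine sum_congr rfl fun s _ => ?_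
          rw [map_mul, Complex.conj_ofReal, ← AddChar.map_neg_eq_conj, ← AddChar.neg_apply,
            neg_sub]
        have hins : good (insert ψ Λ) := by
          refine ⟨fun ψ' h' => ?_, fun ψ₁ h₁ ψ₂ h₂ hne => ?_⟩
          · rcases mem_insert.1 h' with rfl | h'
            · exact hψ
            · exact hgood.1 _ h'
          · rcases mem_insert.1 h₁ with rfl | h₁' <;> rcases mem_insert.1 h₂ with rfl | h₂'
            · exact absurd rfl hne
            · exact hcon _ h₂'
            · rw [hsymm]; exact hcon _ h₁'
            · exact hgood.2 _ h₁' _ h₂' hne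
        have := hmax _ (mem_filter.2 ⟨mem_univ _, hins⟩)
        rw [card_insert_of_notMem hmem] at this
        omega
      obtain ⟨ψ', hψ', hlt⟩ := hbig
      refine ⟨ψ', hψ', fun t => ?_⟩
      have h1 := norm_one_sub_mul_le hp hK (ψ - ψ') t
      have h2 : ‖1 - (ψ - ψ') t‖ ≤ 4 * K / (η ^ 2 * ε) * p t := by
        have h3 : ‖1 - (ψ - ψ') t‖ * θ ≤ 2 * (K * p t) :=
          (mul_le_mul_of_nonneg_left hlt.le (norm_nonneg _)).trans h1
        rw [div_mul_eq_mul_div, le_div_iff₀ (by positivity)]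
        rw [hθ] at h3
        linarith
      have h4 : 1 - ψ t = (1 - ψ' t) + ψ' t * (1 - (ψ - ψ') t) := by
        have : ψ' t * ψ' (-t) = 1 := by
          rw [← AddChar.map_add_eq_mul, add_neg_cancel, AddChar.map_zero_eq_one]
        rw [AddChar.sub_apply]
        linear_combination ψ t * this
      calc ‖1 - ψ t‖ ≤ ‖1 - ψ' t‖ + ‖ψ' t * (1 - (ψ - ψ') t)‖ := by
            rw [h4]; exact norm_add_le _ _
        _ ≤ _ := by rw [norm_mul, AddChar.norm_apply, one_mul]; linarith

end

section

variable {G : Type*} [AddCommGroup G] [Fintype G]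

/-- The `ℓ²`-normalised localisation of `f` at scale `K`. -/
noncomputable def localise (p : G → ℝ) (K : ℝ) (f : G → ℝ) (x : G) : ℝ :=
  f x * (Real.exp (-(K * p x / 2)) / √(mass p K))

lemma localise_mul (p : G → ℝ) (K : ℝ) (f : G → ℝ) (x y : G) :
    localise p K f x * localise p K f y =
      f x * f y * (Real.exp (-(K * p x / 2)) * Real.exp (-(K * p y / 2)) / mass p K) := by
  have h : √(mass p K) * √(mass p K) = mass p K := Real.mul_self_sqrt (mass_pos p K).le
  unfold localise
  rw [mul_mul_mul_comm, div_mul_div_comm, h]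

lemma sum_localise_sq_le (p : G → ℝ) (K : ℝ) {f : G → ℝ} (hf : ∀ x, 0 ≤ f x)
    (hf1 : ∀ x, f x ≤ 1) : ∑ x, localise p K f x ^ 2 ≤ 1 := by
  rw [← sum_weight p K]
  refine sum_le_sum fun x _ => ?_
  rw [pow_two, localise_mul, ← Real.exp_add]
  have h : -(K * p x / 2) + -(K * p x / 2) = -(K * p x) := by ring
  rw [h]
  exact mul_le_of_le_one_left (weight_nonneg p K x) (mul_le_one₀ (hf1 x) (hf x) (hf1 x))

lemma localise_mul_le {p : G → ℝ} (hp : IsLength p) {K : ℝ} (hK : 0 ≤ K) {f : G → ℝ}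
    (hf : ∀ x, 0 ≤ f x) (x y : G) :
    localise p K f x * localise p K f y ≤ f x * f y / mass p K := by
  have h0 : ∀ z, Real.exp (-(K * p z / 2)) ≤ 1 := fun z =>
    Real.exp_le_one_iff.2 (by have := mul_nonneg hK (hp.nonneg z); linarith)
  have hm := mass_pos p K
  rw [localise_mul, mul_div_assoc' (f x * f y)]
  exact div_le_div_of_nonneg_right (mul_le_of_le_one_right (mul_nonneg (hf x) (hf y))
    (mul_le_one₀ (h0 x) (Real.exp_pos _).le (h0 y))) hm.le

lemma le_localise_mul {p : G → ℝ} (hp : IsLength p) {K : ℝ} (hK : 0 ≤ K) {f : G → ℝ}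
    (hf : ∀ x, 0 ≤ f x) (hf1 : ∀ x, f x ≤ 1) (x s t : G) :
    weight p K x * (f x * f (x + s + t) - K * (p s + p t)) ≤
      localise p K f x * localise p K f (x + s + t) := by
  have hm := mass_pos p K
  have hs := mul_nonneg hK (hp.nonneg s)
  have ht := mul_nonneg hK (hp.nonneg t)
  have hpy : K * p (x + s + t) ≤ K * p x + K * (p s + p t) := by
    have h1 := hp.map_add_le (x + s) t
    have h2 := hp.map_add_le x s
    nlinarith
  have hexp : Real.exp (-(K * p x)) * (1 - K * (p s + p t)) ≤
      Real.exp (-(K * p x / 2)) * Real.exp (-(K * p (x + s + t) / 2)) := by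
    rw [← Real.exp_add]
    calc _ ≤ Real.exp (-(K * p x)) * Real.exp (-(K * (p s + p t))) := by
          gcongr
          have := Real.add_one_le_exp (-(K * (p s + p t)))
          linarith
      _ ≤ _ := by
          rw [← Real.exp_add]
          apply Real.exp_le_exp.2
          linarith
  have hff : f x * f (x + s + t) ≤ 1 := mul_le_one₀ (hf1 _) (hf _) (hf1 _)
  have hff0 : 0 ≤ f x * f (x + s + t) := mul_nonneg (hf _) (hf _)
  calc weight p K x * (f x * f (x + s + t) - K * (p s + p t))
      ≤ weight p K x * (f x * f (x + s + t) * (1 - K * (p s + p t))) := by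
        refine mul_le_mul_of_nonneg_left ?_ (weight_nonneg _ _ _)
        nlinarith
    _ = f x * f (x + s + t) * (Real.exp (-(K * p x)) * (1 - K * (p s + p t)) / mass p K) := by
        unfold weight; ring
    _ ≤ _ := by
        rw [localise_mul]
        gcongr

/-- If no average of `f` over a translate of `ν` exceeds `M`, and `M` is close to the average `m`
of `f`, then `f * ν` is close to `m` almost everywhere, so it correlates with `f`. -/
lemma le_correlation_average {p : G → ℝ} (hp : IsLength p) {K : ℝ} (hK : 0 ≤ K) {f : G → ℝ}
    (hf : ∀ x, 0 ≤ f x) (hf1 : ∀ x, f x ≤ 1) {e ν : G → ℝ} (he : ∀ s, 0 ≤ e s)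
    (hν : ∀ t, 0 ≤ ν t) (hν1 : ∑ t, ν t = 1) {m M : ℝ} (hm : m = ∑ x, weight p K x * f x)
    (hM : ∀ x, ∑ t, ν t * f (x + t) ≤ M) :
    (∑ s, e s) * (M * m - M + m) -
        3 * (K * ∑ s, e s * p s + (∑ s, e s) * (K * ∑ t, ν t * p t)) ≤
      ∑ x, localise p K f x * ∑ s, e s * ∑ t, ν t * localise p K f (x + s + t) := by
  set ε := ∑ s, e s with hε
  set err := K * ∑ s, e s * p s + ε * (K * ∑ t, ν t * p t) with herr
  set A : G → ℝ := fun x => ∑ s, e s * ∑ t, ν t * f (x + s + t) with hA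
  have hsum_err : ∑ s, e s * ∑ t, ν t * (K * (p s + p t)) = err := by
    have h1 : ∀ s, ∑ t, ν t * (K * (p s + p t)) = K * p s + K * ∑ t, ν t * p t := by
      intro s
      calc _ = ∑ t, (ν t * (K * p s) + K * (ν t * p t)) := sum_congr rfl fun t _ => by ring
        _ = _ := by rw [sum_add_distrib, ← sum_mul, hν1, one_mul, ← mul_sum]
    simp only [h1]
    simp only [mul_add, sum_add_distrib]
    rw [← sum_mul, herr]
    congr 1
    rw [mul_sum]
    exact sum_congr rfl fun s _ => by ring
  have hconst : ∀ c : ℝ, ∑ s, e s * ∑ t, ν t * c = ε * c := by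
    intro c
    have h1 : ∑ t, ν t * c = c := by rw [← sum_mul, hν1, one_mul]
    rw [h1, ← sum_mul]
  have hstepA : ∀ x, weight p K x * (f x * A x - err) ≤
      localise p K f x * ∑ s, e s * ∑ t, ν t * localise p K f (x + s + t) := by
    intro x
    calc weight p K x * (f x * A x - err)
        = ∑ s, e s * ∑ t, ν t *
            (weight p K x * (f x * f (x + s + t) - K * (p s + p t))) := by
          rw [← hsum_err, hA]
          simp only [mul_sum, ← sum_sub_distrib]
          exact sum_congr rfl fun s _ => sum_congr rfl fun t _ => by ring
      _ ≤ ∑ s, e s * ∑ t, ν t * (localise p K f x * localise p K f (x + s + t)) := by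
          refine sum_le_sum fun s _ => mul_le_mul_of_nonneg_left (sum_le_sum fun t _ =>
            mul_le_mul_of_nonneg_left (le_localise_mul hp hK hf hf1 x s t) (hν t)) (he s)
      _ = _ := by
          simp only [mul_sum]
          exact sum_congr rfl fun s _ => sum_congr rfl fun t _ => by ring
  have hstepB : ε * m - 2 * err ≤ ∑ x, weight p K x * A x := by
    have h1 : ∑ x, weight p K x * A x =
        ∑ s, e s * ∑ t, ν t * ∑ x, weight p K x * f (x + (s + t)) := by
      simp only [hA, mul_sum]
      rw [sum_comm]
      refine sum_congr rfl fun s _ => ?_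
      rw [sum_comm]
      exact sum_congr rfl fun t _ => sum_congr rfl fun x _ => by rw [add_assoc]; ring
    have h2 : ε * m - 2 * err = ∑ s, e s * ∑ t, ν t * (m - 2 * (K * (p s + p t))) := by
      rw [← hsum_err, ← hconst, mul_sum, ← sum_sub_distrib]
      refine sum_congr rfl fun s _ => ?_
      simp only [mul_sum, ← sum_sub_distrib]
      exact sum_congr rfl fun t _ => by ring
    rw [h1, h2]
    refine sum_le_sum fun s _ => mul_le_mul_of_nonneg_left (sum_le_sum fun t _ =>
      mul_le_mul_of_nonneg_left ?_ (hν t)) (he s)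
    have h3 := sum_weight_mul_le_translate hp hK hf hf1 (s + t)
    have h4 : K * p (s + t) ≤ K * (p s + p t) :=
      mul_le_mul_of_nonneg_left (hp.map_add_le s t) hK
    rw [hm]
    linarith
  have hAM : ∀ x, A x ≤ ε * M := by
    intro x
    rw [hA, hε, sum_mul]
    exact sum_le_sum fun s _ => mul_le_mul_of_nonneg_left (hM (x + s)) (he s)
  have hstepC : ∑ x, weight p K x * (A x - ε * M + f x * (ε * M) - err) ≤
      ∑ x, weight p K x * (f x * A x - err) := by
    refine sum_le_sum fun x _ => mul_le_mul_of_nonneg_left ?_ (weight_nonneg _ _ _)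
    nlinarith [hAM x, hf x, hf1 x]
  have hexpand : ∑ x, weight p K x * (A x - ε * M + f x * (ε * M) - err) =
      ∑ x, weight p K x * A x - ε * M + m * (ε * M) - err := by
    simp only [mul_add, mul_sub, sum_add_distrib, sum_sub_distrib, ← mul_assoc, ← sum_mul,
      sum_weight, one_mul]
    rw [hm]
  have := sum_le_sum fun x (_ : x ∈ univ) => hstepA x
  linarith

/-- If many elements at scale `K'` are rarely differences of points of `f`, then `f` has increased
density for some length obtained by adding few characters. -/
lemma exists_density_increment {p : G → ℝ} (hp : IsLength p) {K K' : ℝ} (hK : 0 ≤ K)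
    (hK' : 0 ≤ K') {f : G → ℝ} (hf : ∀ x, 0 ≤ f x) (hf1 : ∀ x, f x ≤ 1) (E : Finset G)
    {ε η δ : ℝ} (hε : 0 < ε) (hη : 0 < η) (hδ : 0 ≤ δ) (hδη : 9 * η < δ ^ 2)
    (hE : ε ≤ ∑ s ∈ E, weight p K' s)
    (hpop : ∀ s ∈ E, ∑ x, f x * f (x + s) ≤ η * mass p K)
    (hmom : K * ∑ t, weight p K' t * p t ≤ η * ε) (hdens : δ ≤ dens p K f) :
    ∃ Λ : Finset (AddChar G ℂ), (Λ.card : ℝ) ≤ 2 / (η ^ 2 * ε) ∧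
      ∀ p' : G → ℝ, IsLength p' → (∀ t, p t ≤ p' t) → (∀ ψ ∈ Λ, ∀ t, ‖1 - ψ t‖ ≤ p' t) →
        ∀ K'' : ℝ, (1 + 4 * K' / (η ^ 2 * ε)) * ∑ t, weight p' K'' t * p' t ≤ η →
          K * ∑ t, weight p' K'' t * p' t ≤ η →
            dens p K f + (δ ^ 2 - 9 * η) ≤ dens p' K'' f := by
  classical
  obtain ⟨Λ, hcard, hΛ⟩ := exists_spectrum_cover hp hK' E hε hη hE
  refine ⟨Λ, hcard, fun p' hp' hle hchar K'' hmom' hmom'' => ?_⟩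
  obtain ⟨x₀, hx₀⟩ := exists_eq_dens p K f
  set m := dens p K f
  set M := dens p' K'' f
  set g : G → ℝ := fun x => f (x₀ + x) with hg
  have hg0 : ∀ x, 0 ≤ g x := fun x => hf _
  have hg1 : ∀ x, g x ≤ 1 := fun x => hf1 _
  set e : G → ℝ := fun s => if s ∈ E then weight p K' s else 0 with he
  have he0 : ∀ s, 0 ≤ e s := fun s => by
    simp only [he]; split_ifs
    · exact weight_nonneg _ _ _
    · exact le_rfl
  have hele : ∀ s, e s ≤ weight p K' s := fun s => by
    simp only [he]; split_ifs
    · exact le_rfl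
    · exact weight_nonneg _ _ _
  have hesum : ∑ s, e s = ∑ s ∈ E, weight p K' s := by simp [he]
  have hehat : ∀ ψ : AddChar G ℂ, ∑ s, (e s : ℂ) * ψ s = ∑ s ∈ E, (weight p K' s : ℂ) * ψ s := by
    intro ψ
    simp only [he, apply_ite Complex.ofReal, ite_mul, Complex.ofReal_zero, zero_mul]
    rw [sum_ite_mem, univ_inter]
  set ε₀ := ∑ s, e s with hε₀
  have hεε₀ : ε ≤ ε₀ := by rw [hesum]; exact hE
  have hε₀pos : 0 < ε₀ := hε.trans_le hεε₀
  set ν := weight p' K'' with hν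
  have hν0 : ∀ t, 0 ≤ ν t := weight_nonneg p' K''
  have hν1 : ∑ t, ν t = 1 := sum_weight p' K''
  have hfour : ∀ ψ : AddChar G ℂ,
      ‖∑ s, (e s : ℂ) * ψ s‖ * ‖1 - ∑ t, (ν t : ℂ) * ψ t‖ ≤ 2 * η * ε₀ := by
    intro ψ
    have hone : (1 : ℂ) - ∑ t, (ν t : ℂ) * ψ t = ∑ t, (ν t : ℂ) * (1 - ψ t) := by
      simp only [mul_sub, mul_one, sum_sub_distrib, ← Complex.ofReal_sum, hν1,
        Complex.ofReal_one]
    have hle1 : ‖(1 : ℂ) - ∑ t, (ν t : ℂ) * ψ t‖ ≤ ∑ t, ν t * ‖1 - ψ t‖ := by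
      rw [hone]
      refine (norm_sum_le _ _).trans_eq (sum_congr rfl fun t _ => ?_)
      rw [norm_mul, Complex.norm_real, Real.norm_of_nonneg (hν0 t)]
    by_cases hψ : η * ε₀ ≤ ‖∑ s, (e s : ℂ) * ψ s‖
    · rw [hehat, hesum] at hψ
      obtain ⟨ψ', hψ', hcl⟩ := hΛ ψ hψ
      have h1 : ∑ t, ν t * ‖1 - ψ t‖ ≤ η := by
        refine le_trans ?_ hmom'
        rw [mul_sum]
        refine sum_le_sum fun t _ => ?_
        have h2 : 4 * K' / (η ^ 2 * ε) * p t ≤ 4 * K' / (η ^ 2 * ε) * p' t := by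
          gcongr; exact hle t
        calc ν t * ‖1 - ψ t‖ ≤ ν t * (p' t + 4 * K' / (η ^ 2 * ε) * p' t) :=
              mul_le_mul_of_nonneg_left
                ((hcl t).trans (add_le_add (hchar ψ' hψ' t) h2)) (hν0 t)
          _ = _ := by ring
      have h2 : ‖∑ s, (e s : ℂ) * ψ s‖ ≤ ε₀ := by
        refine (norm_sum_le _ _).trans_eq (sum_congr rfl fun s _ => ?_)
        rw [norm_mul, Complex.norm_real, Real.norm_of_nonneg (he0 s), AddChar.norm_apply, mul_one]
      calc _ ≤ ε₀ * η := mul_le_mul h2 (hle1.trans h1) (norm_nonneg _) hε₀pos.le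
        _ ≤ _ := by nlinarith
    · have h1 : ∑ t, ν t * ‖1 - ψ t‖ ≤ 2 := by
        refine sum_weight_mul_le p' K'' fun t => ?_
        refine (norm_sub_le _ _).trans ?_
        rw [AddChar.norm_apply, norm_one]
        norm_num
      calc _ ≤ η * ε₀ * 2 := mul_le_mul (not_le.1 hψ).le (hle1.trans h1) (norm_nonneg _)
            (by positivity)
        _ = _ := by ring
  have hsq := sum_localise_sq_le p K hg0 hg1
  have hcorr := abs_correlation_sub_le (by positivity) hsq hsq hfour
  have hsplit : ∑ x, localise p K g x * ∑ s, e s * (localise p K g (x + s) -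
        ∑ t, ν t * localise p K g (x + s + t)) =
      ∑ x, localise p K g x * ∑ s, e s * localise p K g (x + s) -
        ∑ x, localise p K g x * ∑ s, e s * ∑ t, ν t * localise p K g (x + s + t) := by
    simp only [mul_sub, sum_sub_distrib]
  have hlow := le_correlation_average hp hK hg0 hg1 he0 hν0 hν1 (m := m) (M := M) hx₀.symm
    (fun x => by simpa only [hg, add_assoc] using le_dens p' K'' f (x₀ + x))
  have hup : ∑ x, localise p K g x * ∑ s, e s * localise p K g (x + s) ≤ ε₀ * η := by
    have h1 : ∑ x, localise p K g x * ∑ s, e s * localise p K g (x + s) =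
        ∑ s, e s * ∑ x, localise p K g x * localise p K g (x + s) := by
      simp only [mul_sum]
      rw [sum_comm]
      exact sum_congr rfl fun s _ => sum_congr rfl fun x _ => by ring
    rw [h1, hε₀, sum_mul]
    refine sum_le_sum fun s _ => ?_
    by_cases hs : s ∈ E
    · refine mul_le_mul_of_nonneg_left ?_ (he0 s)
      calc _ ≤ ∑ x, g x * g (x + s) / mass p K :=
            sum_le_sum fun x _ => localise_mul_le hp hK hg0 x (x + s)
        _ = (∑ x, f x * f (x + s)) / mass p K := by
            rw [← sum_div]
            congr 1
            have := Equiv.sum_comp (Equiv.addLeft x₀) fun x => f x * f (x + s)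
            simpa only [hg, Equiv.coe_addLeft, add_assoc] using this
        _ ≤ η := by
            rw [div_le_iff₀ (mass_pos p K)]; exact hpop s hs
    · simp [he, hs]
  have hmE : K * ∑ s, e s * p s ≤ η * ε₀ := by
    calc K * ∑ s, e s * p s ≤ K * ∑ t, weight p K' t * p t :=
          mul_le_mul_of_nonneg_left (sum_le_sum fun s _ =>
            mul_le_mul_of_nonneg_right (hele s) (hp.nonneg s)) hK
      _ ≤ η * ε := hmom
      _ ≤ η * ε₀ := by gcongr
  have hmν : ε₀ * (K * ∑ t, ν t * p t) ≤ ε₀ * η := by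
    refine mul_le_mul_of_nonneg_left (le_trans ?_ hmom'') hε₀pos.le
    exact mul_le_mul_of_nonneg_left (sum_le_sum fun s _ =>
      mul_le_mul_of_nonneg_left (hle s) (hν0 s)) hK
  have hfin : M * m - M + m ≤ 9 * η := by
    rw [hsplit] at hcorr
    have h1 := (abs_le.1 hcorr).1
    have h2 : ε₀ * (M * m - M + m) ≤ ε₀ * (9 * η) := by linarith
    exact le_of_mul_le_mul_left h2 hε₀pos
  have hm1 : m ≤ 1 := dens_le_one p K hf1
  have hmδ : δ ^ 2 ≤ m ^ 2 := by gcongr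
  have hm0 : 0 ≤ m := hδ.trans hdens
  have hc : m ^ 2 - 9 * η ≤ (M - m) * (1 - m) := by linarith
  have hpos : 0 < M - m := by
    by_contra! hcon
    nlinarith
  nlinarith

end

section

/-- The indicator function of a colour class. -/
noncomputable def colourClass {X : Type*} {r : ℕ} (χ : X → Fin r) (j : Fin r) (x : X) : ℝ :=
  if χ x = j then 1 else 0

lemma colourClass_nonneg {X : Type*} {r : ℕ} (χ : X → Fin r) (j : Fin r) (x : X) :
    0 ≤ colourClass χ j x := by
  unfold colourClass; split_ifs <;> norm_num

lemma colourClass_le_one {X : Type*} {r : ℕ} (χ : X → Fin r) (j : Fin r) (x : X) :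
    colourClass χ j x ≤ 1 := by
  unfold colourClass; split_ifs <;> norm_num

lemma sum_colourClass {X : Type*} {r : ℕ} (χ : X → Fin r) (x : X) : ∑ j, colourClass χ j x = 1 := by
  simp [colourClass]

variable {G : Type*} [AddCommGroup G]

/-- The length measuring how far the characters in `N` are from `1` on the first `k + 1` points of
the `φ`-orbit. -/
noncomputable def orbitLength (φ : G ≃+ G) (N : Finset (AddChar G ℂ)) (k : ℕ) (t : G) : ℝ :=
  ∑ γ ∈ N, ∑ s ∈ range (k + 1), ‖1 - γ (φ^[s] t)‖

lemma orbitLength_mono (φ : G ≃+ G) {N N' : Finset (AddChar G ℂ)} (hN : N ⊆ N') (k : ℕ) (t : G) :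
    orbitLength φ N k t ≤ orbitLength φ N' k t :=
  sum_le_sum_of_subset_of_nonneg hN fun _ _ _ => sum_nonneg fun _ _ => norm_nonneg _

lemma orbitLength_apply_le (φ : G ≃+ G) (N : Finset (AddChar G ℂ)) {k l : ℕ} (hkl : k < l)
    (t : G) : orbitLength φ N k (φ t) ≤ orbitLength φ N l t := by
  refine sum_le_sum fun γ _ => ?_
  rw [sum_range_succ' _ l]
  simp only [← Function.iterate_succ_apply]
  exact (sum_le_sum_of_subset_of_nonneg (range_subset_range.2 hkl)
    fun _ _ _ => norm_nonneg _).trans (le_add_of_nonneg_right (norm_nonneg _))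

lemma norm_one_sub_le_orbitLength (φ : G ≃+ G) {N : Finset (AddChar G ℂ)} {γ : AddChar G ℂ}
    (hγ : γ ∈ N) (k : ℕ) (t : G) : ‖1 - γ t‖ ≤ orbitLength φ N k t :=
  (single_le_sum (f := fun s => ‖1 - γ (φ^[s] t)‖) (fun _ _ => norm_nonneg _)
    (mem_range.2 k.succ_pos)).trans
    (single_le_sum (f := fun γ : AddChar G ℂ => ∑ s ∈ range (k + 1), ‖1 - γ (φ^[s] t)‖)
      (fun _ _ => sum_nonneg fun _ _ => norm_nonneg _) hγ)

variable [Fintype G]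

lemma orbitLength_sub_le (φ : G ≃+ G) (N : Finset (AddChar G ℂ)) (k : ℕ) (x y : G) :
    orbitLength φ N k (x - y) ≤
      ∑ i ∈ N ×ˢ range (k + 1), ‖i.1 (φ^[i.2] x) - i.1 (φ^[i.2] y)‖ := by
  rw [sum_product]
  refine (sum_congr rfl fun γ _ => sum_congr rfl fun s _ => ?_).le
  rw [iterate_map_sub, AddChar.map_sub_eq_div]
  have hy : γ (φ^[s] y) ≠ 0 := by
    rw [← norm_ne_zero_iff, AddChar.norm_apply]; exact one_ne_zero
  rw [one_sub_div hy, norm_div, AddChar.norm_apply, div_one, norm_sub_rev]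

lemma isLength_orbitLength (φ : G ≃+ G) (N : Finset (AddChar G ℂ)) (k : ℕ) :
    IsLength (orbitLength φ N k) where
  nonneg t := sum_nonneg fun _ _ => sum_nonneg fun _ _ => norm_nonneg _
  map_neg t := by
    refine sum_congr rfl fun γ _ => sum_congr rfl fun s _ => ?_
    have h0 : γ (φ^[s] t) ≠ 0 := by
      rw [← norm_ne_zero_iff, AddChar.norm_apply]; exact one_ne_zero
    rw [iterate_map_neg, AddChar.map_neg_eq_inv, ← norm_neg (1 - γ (φ^[s] t)), neg_sub]
    have : 1 - (γ (φ^[s] t))⁻¹ = (γ (φ^[s] t) - 1) / γ (φ^[s] t) := by field_simp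
    rw [this, norm_div, AddChar.norm_apply, div_one]
  map_add_le x y := by
    unfold orbitLength
    simp only [← sum_add_distrib]
    refine sum_le_sum fun γ _ => sum_le_sum fun s _ => ?_
    rw [iterate_map_add, AddChar.map_add_eq_mul]
    have : 1 - γ (φ^[s] x) * γ (φ^[s] y) =
        (1 - γ (φ^[s] x)) + γ (φ^[s] x) * (1 - γ (φ^[s] y)) := by ring
    rw [this]
    refine (norm_add_le _ _).trans_eq ?_
    rw [norm_mul, AddChar.norm_apply, one_mul]

lemma le_mass_orbitLength (φ : G ≃+ G) (N : Finset (AddChar G ℂ)) (k : ℕ) {K : ℕ} (hK : 1 ≤ K)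
    {D : ℝ} (hD : 2 * (N.card * (k + 1)) * (3 + Real.log K) ≤ D) :
    Real.exp (-D) * Fintype.card G ≤ mass (orbitLength φ N k) K := by
  have hK0 : (1 : ℝ) ≤ K := by exact_mod_cast hK
  have h := card_le_mul_mass (N ×ˢ range (k + 1)) (fun i x => i.1 (φ^[i.2] x))
    (fun i x => (AddChar.norm_apply _ _).le) (orbitLength_sub_le φ N k) hK
  have hbase : (2 * K + 1 : ℝ) ≤ Real.exp (2 + Real.log K) := by
    rw [Real.exp_add, Real.exp_log (by linarith)]
    have := Real.add_one_le_exp 2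
    nlinarith
  have hpow : Real.exp (2 * (N ×ˢ range (k + 1)).card) *
      (2 * K + 1 : ℝ) ^ (2 * (N ×ˢ range (k + 1)).card) ≤ Real.exp D := by
    calc _ ≤ Real.exp (2 * (N ×ˢ range (k + 1)).card) *
          Real.exp (2 + Real.log K) ^ (2 * (N ×ˢ range (k + 1)).card) := by gcongr
      _ = Real.exp (2 * (N.card * (k + 1)) * (3 + Real.log K)) := by
          rw [← Real.exp_nat_mul, ← Real.exp_add, card_product, card_range]
          congr 1
          push_cast
          ring
      _ ≤ _ := Real.exp_le_exp.2 hD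
  have hm := mass_pos (orbitLength φ N k) K
  rw [Real.exp_neg, inv_mul_le_iff₀ (Real.exp_pos _)]
  exact h.trans (mul_le_mul_of_nonneg_right hpow hm.le)

/-- If `φ` maps almost all of each colour class `j` into `E j`, then at one of `r + 1` well
separated scales some colour class is dense while the corresponding `E j` is large. -/
lemma exists_dense_and_large [DecidableEq G] {r : ℕ} (hr : 1 ≤ r) (χ : G → Fin r) (φ : G ≃+ G) {p : ℕ → G → ℝ}
    (hp : ∀ k, IsLength (p k)) (hφ : ∀ k l, k < l → ∀ t, p k (φ t) ≤ p l t) {K K' : ℕ → ℝ}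
    (hK : ∀ k, 0 < K k) (hK' : ∀ k, 0 ≤ K' k) {D κ : ℝ} (hD : 0 ≤ D)
    (hZ : ∀ k ≤ r, Real.exp (-D) * Fintype.card G ≤ mass (p k) (K k))
    (hZ' : ∀ k ≤ r, Real.exp (-D) * Fintype.card G ≤ mass (p k) (K' k))
    (hsep : ∀ k l, k < l → l ≤ r → 2 * K' k * ((2 * D + 1) / K l) ≤ 1 / (4 * r))
    (E : Fin r → Finset G)
    (hE : ∀ j, ∑ x with φ x ∉ E j, colourClass χ j x ≤ κ * Fintype.card G)
    (hκ : κ ≤ Real.exp (-D) * (1 / (8 * r))) :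
    ∃ k ≤ r, ∃ j, 1 / (2 * r) ≤ dens (p k) (K k) (colourClass χ j) ∧
      1 / (8 * r) ≤ ∑ s ∈ E j, weight (p k) (K' k) s := by
  have hr0 : (0 : ℝ) < r := by exact_mod_cast hr
  have hG : (0 : ℝ) < Fintype.card G := by exact_mod_cast Fintype.card_pos
  by_contra! hcon
  have hmassφ : ∀ k, mass (fun t => p k (φ t)) (K' k) = mass (p k) (K' k) := fun k =>
    Equiv.sum_comp φ.toEquiv fun t => Real.exp (-(K' k * p k t))
  have hweightφ : ∀ k t, weight (fun t => p k (φ t)) (K' k) t = weight (p k) (K' k) (φ t) :=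
    fun k t => by unfold weight; rw [hmassφ]
  have hex : ∀ k ≤ r, ∃ j, dens (p k) (K k) (colourClass χ j) < 1 / (2 * r) ∧
      3 / (4 * r) ≤ ∑ x, weight (fun t => p k (φ t)) (K' k) x * colourClass χ j x := by
    intro k hk
    by_contra! hno
    have hlt : ∀ j, ∑ x, weight (fun t => p k (φ t)) (K' k) x * colourClass χ j x <
        1 / r := by
      intro j
      by_cases hd : dens (p k) (K k) (colourClass χ j) < 1 / (2 * r)
      · refine (hno j hd).trans ?_
        rw [div_lt_div_iff₀ (by positivity) hr0]
        linarith
      · have h1 := hcon k hk j (not_lt.1 hd)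
        have hin : ∑ x with φ x ∈ E j,
            weight (fun t => p k (φ t)) (K' k) x * colourClass χ j x ≤
              ∑ s ∈ E j, weight (p k) (K' k) s := by
          calc _ ≤ ∑ x with φ x ∈ E j, weight (p k) (K' k) (φ x) := by
                refine sum_le_sum fun x _ => ?_
                rw [hweightφ]
                exact mul_le_of_le_one_right (weight_nonneg _ _ _) (colourClass_le_one χ j x)
            _ = ∑ s ∈ E j, weight (p k) (K' k) s := by
                rw [sum_filter]
                have := Equiv.sum_comp φ.toEquiv
                  fun s => if s ∈ E j then weight (p k) (K' k) s else 0
                simpa using this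
        have hout : ∑ x with φ x ∉ E j,
            weight (fun t => p k (φ t)) (K' k) x * colourClass χ j x ≤ 1 / (8 * r) := by
          have hm := mass_pos (p k) (K' k)
          calc _ ≤ ∑ x with φ x ∉ E j, 1 / mass (p k) (K' k) * colourClass χ j x := by
                refine sum_le_sum fun x _ => ?_
                rw [hweightφ]
                exact mul_le_mul_of_nonneg_right (weight_le (hp k) (hK' k) _)
                  (colourClass_nonneg χ j x)
            _ ≤ 1 / mass (p k) (K' k) * (κ * Fintype.card G) := by
                rw [← mul_sum]
                exact mul_le_mul_of_nonneg_left (hE j) (by positivity)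
            _ ≤ 1 / (8 * r) := by
                rw [one_div_mul_eq_div, div_le_iff₀ hm]
                calc κ * Fintype.card G ≤
                      Real.exp (-D) * (1 / (8 * r)) * Fintype.card G := by gcongr
                  _ = 1 / (8 * r) * (Real.exp (-D) * Fintype.card G) := by ring
                  _ ≤ _ := by gcongr; exact hZ' k hk
        rw [← sum_filter_add_sum_filter_not univ fun x => φ x ∈ E j]
        have h8 : (1 : ℝ) / (8 * r) = 1 / 8 * (1 / r) := by rw [div_mul_div_comm, one_mul]
        have : (0 : ℝ) < 1 / r := by positivity
        linarith
    have htot : ∑ j : Fin r, ∑ x,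
        weight (fun t => p k (φ t)) (K' k) x * colourClass χ j x = 1 := by
      rw [sum_comm]
      simp only [← mul_sum, sum_colourClass, mul_one, sum_weight]
    have : ∑ j : Fin r, ∑ x, weight (fun t => p k (φ t)) (K' k) x * colourClass χ j x <
        ∑ _j : Fin r, (1 / r : ℝ) :=
      sum_lt_sum_of_nonempty ⟨⟨0, hr⟩, mem_univ _⟩ fun j _ => hlt j
    rw [htot, sum_const, card_univ, Fintype.card_fin, nsmul_eq_mul, mul_one_div_cancel hr0.ne']
      at this
    exact lt_irrefl _ this
  choose j hj using fun k : Fin (r + 1) => hex k (Nat.lt_succ_iff.1 k.2)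
  have hne : ∀ k l : Fin (r + 1), k < l → j k ≠ j l := by
    intro k l hkl heq
    have hl := Nat.lt_succ_iff.1 l.2
    have h1 := sum_weight_mul_le_dens ((hp k).comp φ) (hp l) (hφ k l hkl) (hK' k) (hK l) hD
      (hZ l hl) (colourClass_nonneg χ (j k)) (colourClass_le_one χ (j k)) 0
    simp only [zero_add] at h1
    have h2 := hsep k l hkl hl
    have h3 := (hj k).2
    have h4 := (hj l).1
    rw [← heq] at h4
    have e1 : (3 : ℝ) / (4 * r) = 3 / 4 * (1 / r) := by rw [div_mul_div_comm, mul_one]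
    have e2 : (1 : ℝ) / (4 * r) = 1 / 4 * (1 / r) := by rw [div_mul_div_comm, mul_one]
    have e3 : (1 : ℝ) / (2 * r) = 1 / 2 * (1 / r) := by rw [div_mul_div_comm, mul_one]
    linarith
  have hinj : Function.Injective j := by
    intro k l hkl
    by_contra hkl'
    rcases lt_or_gt_of_ne hkl' with h | h
    · exact hne k l h hkl
    · exact hne l k h hkl.symm
  have := Fintype.card_le_of_injective j hinj
  simp at this

end

section

variable {G : Type*} [AddCommGroup G] [Fintype G]

/-- The total density of all colour classes over `r + 1` successive scales. -/
noncomputable def potential (φ : G ≃+ G) {r : ℕ} (χ : G → Fin r) (Q : ℝ)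
    (N : Finset (AddChar G ℂ)) (i : ℕ) : ℝ :=
  ∑ a ∈ range (r + 1) ×ˢ (univ : Finset (Fin r)),
    dens (orbitLength φ N a.1) (Q ^ (2 * (i + a.1))) (colourClass χ a.2)

lemma potential_nonneg (φ : G ≃+ G) {r : ℕ} (χ : G → Fin r) (Q : ℝ)
    (N : Finset (AddChar G ℂ)) (i : ℕ) : 0 ≤ potential φ χ Q N i :=
  sum_nonneg fun a _ => dens_nonneg _ _ (colourClass_nonneg χ a.2)

lemma potential_le (φ : G ≃+ G) {r : ℕ} (χ : G → Fin r) (Q : ℝ)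
    (N : Finset (AddChar G ℂ)) (i : ℕ) : potential φ χ Q N i ≤ (r + 1) * r := by
  refine (sum_le_sum fun a _ => dens_le_one _ _ (colourClass_le_one χ a.2)).trans_eq ?_
  simp

lemma exists_potential_increment [DecidableEq G] {r : ℕ} (hr : 1 ≤ r) (χ : G → Fin r)
    (φ : G ≃+ G) {Q D B κ : ℝ} {m i : ℕ} (hD : 0 ≤ D)
    (hQ : (2 * D + 1) * (12000000 * (r : ℝ) ^ 7) ≤ Q)
    (hZ : ∀ N : Finset (AddChar G ℂ), (N.card : ℝ) ≤ B → ∀ k ≤ r, ∀ n ≤ m,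
      Real.exp (-D) * Fintype.card G ≤ mass (orbitLength φ N k) (Q ^ n))
    (hκ : κ ≤ Real.exp (-D) * (1 / (72 * (r : ℝ) ^ 2))) (E : Fin r → Finset G)
    (hpop : ∀ j, ∀ s ∈ E j,
      ∑ x, colourClass χ j x * colourClass χ j (x + s) ≤ κ * Fintype.card G)
    (hE : ∀ j, ∑ x with φ x ∉ E j, colourClass χ j x ≤ κ * Fintype.card G)
    {N : Finset (AddChar G ℂ)} (hN : N.card + 82944 * (r : ℝ) ^ 5 ≤ B)
    (hi : 2 * (i + 1 + r) ≤ m) :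
    ∃ N' : Finset (AddChar G ℂ), (N'.card : ℝ) ≤ N.card + 82944 * (r : ℝ) ^ 5 ∧
      potential φ χ Q N i + 1 / (16 * (r : ℝ) ^ 2) ≤ potential φ χ Q N' (i + 1) := by
  classical
  have hr1 : (1 : ℝ) ≤ r := by exact_mod_cast hr
  set R := (r : ℝ)
  have hR0 : 0 < R := by linarith
  have hpow : ∀ n, 1 ≤ R ^ n := fun n => one_le_pow₀ hr1
  have hpow_le : ∀ {a b : ℕ}, a ≤ b → R ^ a ≤ R ^ b := fun h => pow_le_pow_right₀ hr1 h
  have hQ1 : 1 ≤ Q := by nlinarith [hpow 7]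
  have hQ0 : 0 < Q := by linarith
  set S := (2 * D + 1) / Q with hS
  have hS0 : 0 ≤ S := by positivity
  have hSle : S * (12000000 * R ^ 7) ≤ 1 := by
    rw [hS, div_mul_eq_mul_div, div_le_one hQ0]; exact hQ
  have hS1 : ∀ (c : ℝ) (n : ℕ), 0 < c → c ≤ 12000000 → n ≤ 7 → S ≤ 1 / (c * R ^ n) := by
    intro c n hc hc' hn
    rw [le_div_iff₀ (by positivity)]
    refine le_trans (mul_le_mul_of_nonneg_left ?_ hS0) hSle
    exact mul_le_mul hc' (hpow_le hn) (by positivity) (by norm_num)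
  have hcardN : (N.card : ℝ) ≤ B := by have := hpow 5; linarith
  obtain ⟨k₀, hk₀, j₀, hdens, hlarge⟩ := exists_dense_and_large hr χ φ
    (p := orbitLength φ N) (K := fun k => Q ^ (2 * (i + k))) (K' := fun k => Q ^ (2 * (i + k) + 1))
    (isLength_orbitLength φ N) (fun k l hkl => orbitLength_apply_le φ N hkl)
    (fun k => by positivity) (fun k => by positivity) hD
    (fun k hk => hZ N hcardN k hk _ (by omega)) (fun k hk => hZ N hcardN k hk _ (by omega))
    (by
      intro k l hkl _
      have h1 : Q ^ (2 * (i + k) + 1) * Q ≤ Q ^ (2 * (i + l)) := by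
        rw [← pow_succ]; exact pow_le_pow_right₀ hQ1 (by omega)
      have h2 : Q ^ (2 * (i + k) + 1) * ((2 * D + 1) / Q ^ (2 * (i + l))) ≤ S := by
        rw [hS, mul_div_assoc', div_le_div_iff₀ (by positivity) hQ0]
        nlinarith
      have h3 := hS1 8 1 (by norm_num) (by norm_num) (by norm_num)
      rw [pow_one] at h3
      have e : (1 : ℝ) / (4 * R) = 2 * (1 / (8 * R)) := by field_simp; norm_num
      change 2 * Q ^ (2 * (i + k) + 1) * ((2 * D + 1) / Q ^ (2 * (i + l))) ≤ 1 / (4 * R)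
      rw [e]
      linarith)
    E hE (hκ.trans (by
      have := hpow 1
      have : (1 : ℝ) / (72 * R ^ 2) ≤ 1 / (8 * R) := by
        apply one_div_le_one_div_of_le (by positivity)
        nlinarith
      gcongr))
  set K := Q ^ (2 * (i + k₀)) with hKdef
  have hK1 : 1 ≤ K := one_le_pow₀ hQ1
  have hK0 : 0 < K := by linarith
  set p := orbitLength φ N k₀ with hpdef
  have hK' : Q ^ (2 * (i + k₀) + 1) = Q * K := by rw [hKdef]; ring
  have hKsucc : ∀ k, Q ^ (2 * (i + 1 + k)) = Q ^ 2 * Q ^ (2 * (i + k)) := fun k => by ring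
  rw [hK'] at hlarge
  obtain ⟨Λ, hΛcard, hΛ⟩ := exists_density_increment (isLength_orbitLength φ N k₀) (K := K)
    (K' := Q * K) hK0.le (by positivity) (colourClass_nonneg χ j₀) (colourClass_le_one χ j₀) (E j₀)
    (ε := 1 / (8 * R)) (η := 1 / (72 * R ^ 2)) (δ := 1 / (2 * R)) (by positivity) (by positivity)
    (by positivity) (by
      have e1 : 9 * (1 / (72 * R ^ 2)) = 1 / 8 * (1 / R ^ 2) := by field_simp; norm_num
      have e2 : (1 / (2 * R)) ^ 2 = 1 / 4 * (1 / R ^ 2) := by field_simp; norm_num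
      have : 0 < 1 / R ^ 2 := by positivity
      rw [e1, e2]; linarith) hlarge
    (by
      intro s hs
      refine (hpop j₀ s hs).trans ?_
      calc κ * Fintype.card G ≤ Real.exp (-D) * (1 / (72 * R ^ 2)) * Fintype.card G := by gcongr
        _ = 1 / (72 * R ^ 2) * (Real.exp (-D) * Fintype.card G) := by ring
        _ ≤ _ := by gcongr; exact hZ N hcardN k₀ hk₀ _ (by omega))
    (by
      have h1 := sum_weight_mul_length_le (isLength_orbitLength φ N k₀) (K := Q * K)
        (by positivity) hD (by rw [← hK']; exact hZ N hcardN k₀ hk₀ _ (by omega))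
      have h2 := hS1 576 3 (by norm_num) (by norm_num) (by norm_num)
      calc _ ≤ K * ((2 * D + 1) / (Q * K)) := mul_le_mul_of_nonneg_left h1 hK0.le
        _ = S := by rw [hS]; field_simp
        _ ≤ _ := h2
        _ = _ := by field_simp; norm_num)
    hdens
  have hcst : 2 / ((1 / (72 * R ^ 2)) ^ 2 * (1 / (8 * R))) = 82944 * R ^ 5 := by
    field_simp; norm_num
  rw [hcst] at hΛcard
  have hcard' : ((N ∪ Λ).card : ℝ) ≤ N.card + 82944 * R ^ 5 := by
    have : ((N ∪ Λ).card : ℝ) ≤ N.card + Λ.card := by exact_mod_cast card_union_le N Λ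
    linarith
  refine ⟨N ∪ Λ, hcard', ?_⟩
  have hZ' : ∀ k ≤ r, Real.exp (-D) * Fintype.card G ≤
      mass (orbitLength φ (N ∪ Λ) k) (Q ^ 2 * Q ^ (2 * (i + k))) := fun k hk => by
    rw [← hKsucc]; exact hZ _ (hcard'.trans hN) k hk _ (by omega)
  have hinc : dens p K (colourClass χ j₀) + 1 / (8 * R ^ 2) ≤
      dens (orbitLength φ (N ∪ Λ) k₀) (Q ^ 2 * K) (colourClass χ j₀) := by
    have h1 := sum_weight_mul_length_le (isLength_orbitLength φ (N ∪ Λ) k₀) (K := Q ^ 2 * K)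
      (by positivity) hD (hZ' k₀ hk₀)
    set w := ∑ t, weight (orbitLength φ (N ∪ Λ) k₀) (Q ^ 2 * K) t * orbitLength φ (N ∪ Λ) k₀ t
    have h2 : Q * K * w ≤ S := by
      calc _ ≤ Q * K * ((2 * D + 1) / (Q ^ 2 * K)) := mul_le_mul_of_nonneg_left h1 (by positivity)
        _ = S := by rw [hS]; field_simp
    have hw0 : 0 ≤ w := sum_nonneg fun t _ =>
      mul_nonneg (weight_nonneg _ _ _) ((isLength_orbitLength φ (N ∪ Λ) k₀).nonneg t)
    have h3 : w ≤ S := by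
      refine le_trans ?_ h2
      exact le_mul_of_one_le_left hw0 (one_le_mul_of_one_le_of_one_le hQ1 hK1)
    have h4 : K * w ≤ S := by
      refine le_trans ?_ h2
      rw [mul_assoc]
      exact le_mul_of_one_le_left (by positivity) hQ1
    have h5 := hΛ (orbitLength φ (N ∪ Λ) k₀) (isLength_orbitLength _ _ _)
      (orbitLength_mono φ subset_union_left k₀)
      (fun ψ hψ => norm_one_sub_le_orbitLength φ (mem_union_right N hψ) k₀) (Q ^ 2 * K)
      (by
        have e : 4 * (Q * K) / ((1 / (72 * R ^ 2)) ^ 2 * (1 / (8 * R))) =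
            165888 * R ^ 5 * (Q * K) := by field_simp; norm_num
        rw [e]
        have h6 := hpow 5
        calc (1 + 165888 * R ^ 5 * (Q * K)) * w = w + 165888 * R ^ 5 * (Q * K * w) := by ring
          _ ≤ S + 165888 * R ^ 5 * S := by gcongr
          _ ≤ 165889 * R ^ 5 * S := by nlinarith
          _ ≤ 1 / (72 * R ^ 2) := by
            rw [le_div_iff₀ (by positivity)]
            calc 165889 * R ^ 5 * S * (72 * R ^ 2) = S * (11944008 * R ^ 7) := by ring
              _ ≤ S * (12000000 * R ^ 7) := by gcongr; norm_num
              _ ≤ 1 := hSle)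
      (h4.trans (hS1 72 2 (by norm_num) (by norm_num) (by norm_num)))
    have e : (1 / (2 * R)) ^ 2 - 9 * (1 / (72 * R ^ 2)) = 1 / (8 * R ^ 2) := by
      field_simp; norm_num
    rw [e] at h5
    exact h5
  have hloss : ∀ k ≤ r, ∀ j, dens (orbitLength φ N k) (Q ^ (2 * (i + k))) (colourClass χ j) ≤
      dens (orbitLength φ (N ∪ Λ) k) (Q ^ 2 * Q ^ (2 * (i + k))) (colourClass χ j) + 2 * S := by
    intro k hk j
    obtain ⟨x₀, hx₀⟩ := exists_eq_dens (orbitLength φ N k) (Q ^ (2 * (i + k))) (colourClass χ j)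
    rw [← hx₀]
    refine (sum_weight_mul_le_dens (isLength_orbitLength φ N k) (isLength_orbitLength φ (N ∪ Λ) k)
      (orbitLength_mono φ subset_union_left k) (by positivity) (by positivity) hD (hZ' k hk)
      (colourClass_nonneg χ j) (colourClass_le_one χ j) x₀).trans ?_
    have : 2 * Q ^ (2 * (i + k)) * ((2 * D + 1) / (Q ^ 2 * Q ^ (2 * (i + k)))) = 2 * (S / Q) := by
      rw [hS]; field_simp
    rw [this]
    have := div_le_self hS0 hQ1
    linarith
  have hsum : ∑ a ∈ range (r + 1) ×ˢ (univ : Finset (Fin r)),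
      (dens (orbitLength φ N a.1) (Q ^ (2 * (i + a.1))) (colourClass χ a.2) +
        if a = (k₀, j₀) then 1 / (8 * R ^ 2) else 0) ≤
      ∑ a ∈ range (r + 1) ×ˢ (univ : Finset (Fin r)),
      (dens (orbitLength φ (N ∪ Λ) a.1) (Q ^ (2 * (i + 1 + a.1))) (colourClass χ a.2) + 2 * S) := by
    refine sum_le_sum fun a ha => ?_
    rw [mem_product, mem_range] at ha
    rw [hKsucc]
    split_ifs with h
    · rw [h]; linarith
    · rw [add_zero]; exact hloss a.1 (Nat.lt_succ_iff.1 ha.1) a.2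
  rw [sum_add_distrib, sum_add_distrib, sum_ite_eq' _ (k₀, j₀), if_pos (by simp; omega), sum_const,
    card_product, card_range, card_univ, Fintype.card_fin, nsmul_eq_mul] at hsum
  have htot : (((r + 1) * r : ℕ) : ℝ) * (2 * S) ≤ 1 / (16 * R ^ 2) := by
    have h1 := hS1 64 4 (by norm_num) (by norm_num) (by norm_num)
    have h2 : (((r + 1) * r : ℕ) : ℝ) ≤ 2 * R ^ 2 := by
      push_cast
      change (R + 1) * R ≤ 2 * R ^ 2
      nlinarith
    calc _ ≤ 2 * R ^ 2 * (2 * (1 / (64 * R ^ 4))) := by gcongr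
      _ = _ := by field_simp; norm_num
  have e : 1 / (8 * R ^ 2) = 1 / (16 * R ^ 2) + 1 / (16 * R ^ 2) := by field_simp; norm_num
  unfold potential
  linarith

end

section

variable {G : Type*} [AddCommGroup G] [Fintype G]

lemma le_mass_orbitLength_of_card_le (φ : G ≃+ G) {r : ℕ} (hr : 1 ≤ r) {Y : ℕ} (hY : 1 ≤ Y)
    {N : Finset (AddChar G ℂ)} (hN : (N.card : ℝ) ≤ 2737152 * (r : ℝ) ^ 9) {k : ℕ} (hk : k ≤ r)
    {n : ℕ} (hn : n ≤ 2 * (33 * r ^ 4 + r)) :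
    Real.exp (-(1600000000 * (r : ℝ) ^ 14 * Y)) * Fintype.card G ≤
      mass (orbitLength φ N k) (((Y : ℝ) ^ 2) ^ n) := by
  have hr1 : (1 : ℝ) ≤ r := by exact_mod_cast hr
  have hY1 : (1 : ℝ) ≤ Y := by exact_mod_cast hY
  have hk' : (k : ℝ) + 1 ≤ 2 * r := by
    have : (k : ℝ) ≤ r := by exact_mod_cast hk
    linarith
  have hpow : (r : ℝ) ≤ (r : ℝ) ^ 4 := le_self_pow₀ hr1 (by norm_num)
  have hr4 : (1 : ℝ) ≤ (r : ℝ) ^ 4 := hr1.trans hpow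
  have hn' : (n : ℝ) ≤ 68 * (r : ℝ) ^ 4 := by
    have : (n : ℝ) ≤ 2 * (33 * (r : ℝ) ^ 4 + r) := by exact_mod_cast hn
    linarith
  have hlog : Real.log Y ≤ Y := Real.log_le_self (by linarith)
  have hlog0 : 0 ≤ Real.log Y := Real.log_nonneg hY1
  have h := le_mass_orbitLength φ N k (K := (Y ^ 2) ^ n) (Nat.one_le_pow _ _ (by positivity))
    (D := 1600000000 * (r : ℝ) ^ 14 * Y) (by
      push_cast
      rw [Real.log_pow, Real.log_pow]
      push_cast
      have h1 : n * (2 * Real.log Y) ≤ 68 * (r : ℝ) ^ 4 * (2 * Y) := by gcongr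
      have h2 : 3 + n * (2 * Real.log Y) ≤ 139 * ((r : ℝ) ^ 4 * Y) := by
        have := one_le_mul_of_one_le_of_one_le hr4 hY1
        linarith
      calc 2 * (N.card * ((k : ℝ) + 1)) * (3 + n * (2 * Real.log Y))
          ≤ 2 * (2737152 * (r : ℝ) ^ 9 * (2 * r)) * (139 * ((r : ℝ) ^ 4 * Y)) := by gcongr
        _ = 1521856512 * (r : ℝ) ^ 14 * Y := by ring
        _ ≤ _ := by gcongr; norm_num)
  exact_mod_cast h

variable [DecidableEq G]

/-- The monochromatic solutions of `φ x = y - z`. -/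
def monochromaticTriples (φ : G ≃+ G) {r : ℕ} (χ : G → Fin r) : Finset (G × G × G) :=
  univ.filter fun t => χ t.1 = χ t.2.1 ∧ χ t.1 = χ t.2.2 ∧ φ t.1 = t.2.1 - t.2.2

lemma sum_correlation_le_card (φ : G ≃+ G) {r : ℕ} (χ : G → Fin r) (j : Fin r) :
    ∑ x, colourClass χ j x * ∑ z, colourClass χ j z * colourClass χ j (z + φ x) ≤
      (monochromaticTriples φ χ).card := by
  have h1 : ∑ x, colourClass χ j x * ∑ z, colourClass χ j z * colourClass χ j (z + φ x) =
      ((univ.filter fun a : G × G => χ a.1 = j ∧ χ a.2 = j ∧ χ (a.2 + φ a.1) = j).card : ℝ) := by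
    rw [card_filter, Nat.cast_sum, ← univ_product_univ, sum_product]
    refine sum_congr rfl fun x _ => ?_
    rw [mul_sum]
    refine sum_congr rfl fun z _ => ?_
    unfold colourClass
    by_cases hx : χ x = j <;> by_cases hz : χ z = j <;> by_cases hy : χ (z + φ x) = j <;>
      simp [hx, hz, hy]
  rw [h1, Nat.cast_le]
  refine card_le_card_of_injOn (fun a => (a.1, a.2 + φ a.1, a.2)) ?_ ?_
  · intro a ha
    obtain ⟨hx, hz, hy⟩ := (mem_filter.1 ha).2
    simp [monochromaticTriples, hx, hz, hy]
  · intro a _ b _ hab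
    simp only [Prod.mk.injEq] at hab
    exact Prod.ext hab.1 hab.2.2

/-- If there are fewer than `κ² |G|²` monochromatic triples, then `φ` maps few elements of a colour
class to popular differences of that class. -/
lemma sum_colourClass_popular_le (φ : G ≃+ G) {r : ℕ} (χ : G → Fin r) {κ : ℝ} (hκ : 0 < κ)
    (hfew : ((monochromaticTriples φ χ).card : ℝ) < κ ^ 2 * (Fintype.card G : ℝ) ^ 2)
    (j : Fin r) {E : Finset G}
    (hE : ∀ s ∉ E, κ * Fintype.card G ≤ ∑ z, colourClass χ j z * colourClass χ j (z + s)) :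
    ∑ x with φ x ∉ E, colourClass χ j x ≤ κ * Fintype.card G := by
  have hG : (0 : ℝ) < Fintype.card G := by exact_mod_cast Fintype.card_pos
  refine le_of_mul_le_mul_right ?_ (mul_pos hκ hG)
  calc (∑ x with φ x ∉ E, colourClass χ j x) * (κ * Fintype.card G)
      ≤ ∑ x with φ x ∉ E, colourClass χ j x *
          ∑ z, colourClass χ j z * colourClass χ j (z + φ x) := by
        rw [sum_mul]
        exact sum_le_sum fun x hx => mul_le_mul_of_nonneg_left
          (hE _ (mem_filter.1 hx).2) (colourClass_nonneg χ j x)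
    _ ≤ ∑ x, colourClass χ j x * ∑ z, colourClass χ j z * colourClass χ j (z + φ x) :=
        sum_le_sum_of_subset_of_nonneg (filter_subset _ _) fun x _ _ =>
          mul_nonneg (colourClass_nonneg χ j x) (sum_nonneg fun z _ =>
            mul_nonneg (colourClass_nonneg χ j z) (colourClass_nonneg χ j _))
    _ ≤ _ := sum_correlation_le_card φ χ j
    _ ≤ κ * Fintype.card G * (κ * Fintype.card G) := by
        refine hfew.le.trans_eq ?_
        ring

theorem le_card_monochromaticTriples (φ : G ≃+ G) {r : ℕ} (hr : 1 ≤ r) (χ : G → Fin r) {κ : ℝ}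
    (hκ0 : 0 < κ)
    (hκ : κ ≤ Real.exp (-(64 * 10 ^ 24 * (r : ℝ) ^ 35)) * (1 / (72 * (r : ℝ) ^ 2))) :
    κ ^ 2 * (Fintype.card G : ℝ) ^ 2 ≤ (monochromaticTriples φ χ).card := by
  by_contra! hfew
  have hr1 : (1 : ℝ) ≤ r := by exact_mod_cast hr
  set Y : ℕ := 4 * 10 ^ 16 * r ^ 21 with hYdef
  have hY : 1 ≤ Y := Nat.one_le_iff_ne_zero.2 (by positivity)
  have hYcast : (Y : ℝ) = 4 * 10 ^ 16 * (r : ℝ) ^ 21 := by rw [hYdef]; push_cast; ring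
  have hY1 : (1 : ℝ) ≤ Y := by exact_mod_cast hY
  set D : ℝ := 1600000000 * (r : ℝ) ^ 14 * Y with hDdef
  have hD0 : 0 ≤ D := by positivity
  have hDeq : D = 64 * 10 ^ 24 * (r : ℝ) ^ 35 := by rw [hDdef, hYcast]; ring
  rw [← hDeq] at hκ
  have hQ : (2 * D + 1) * (12000000 * (r : ℝ) ^ 7) ≤ (Y : ℝ) ^ 2 := by
    have h1 : (1 : ℝ) ≤ (r : ℝ) ^ 14 * Y :=
      one_le_mul_of_one_le_of_one_le (one_le_pow₀ hr1) hY1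
    have h2 : 2 * D + 1 ≤ 3300000000 * ((r : ℝ) ^ 14 * Y) := by rw [hDdef]; linarith
    calc (2 * D + 1) * (12000000 * (r : ℝ) ^ 7)
        ≤ 3300000000 * ((r : ℝ) ^ 14 * Y) * (12000000 * (r : ℝ) ^ 7) := by gcongr
      _ = 39600000000000000 * (r : ℝ) ^ 21 * Y := by ring
      _ ≤ 4 * 10 ^ 16 * (r : ℝ) ^ 21 * Y := by gcongr; norm_num
      _ = (Y : ℝ) ^ 2 := by rw [← hYcast]; ring
  set E : Fin r → Finset G := fun j => univ.filter fun s =>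
    ∑ z, colourClass χ j z * colourClass χ j (z + s) < κ * Fintype.card G with hEdef
  have hpop : ∀ j, ∀ s ∈ E j,
      ∑ x, colourClass χ j x * colourClass χ j (x + s) ≤ κ * Fintype.card G :=
    fun j s hs => (mem_filter.1 hs).2.le
  have hE : ∀ j, ∑ x with φ x ∉ E j, colourClass χ j x ≤ κ * Fintype.card G := fun j =>
    sum_colourClass_popular_le φ χ hκ0 hfew j fun s hs => by simpa [hEdef] using hs
  have hind : ∀ i ≤ 33 * r ^ 4, ∃ N : Finset (AddChar G ℂ),
      (N.card : ℝ) ≤ i * (82944 * (r : ℝ) ^ 5) ∧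
        i * (1 / (16 * (r : ℝ) ^ 2)) ≤ potential φ χ ((Y : ℝ) ^ 2) N i := by
    intro i
    induction i with
    | zero => exact fun _ => ⟨∅, by simp, by simpa using potential_nonneg φ χ _ ∅ 0⟩
    | succ i ih =>
      intro hi
      obtain ⟨N, hN, hpot⟩ := ih (by omega)
      have hi' : (i : ℝ) + 1 ≤ 33 * (r : ℝ) ^ 4 := by exact_mod_cast hi
      have hcard : N.card + 82944 * (r : ℝ) ^ 5 ≤ (i + 1) * (82944 * (r : ℝ) ^ 5) := by linarith
      obtain ⟨N', hN', hpot'⟩ := exists_potential_increment hr χ φ (B := 2737152 * (r : ℝ) ^ 9)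
        (m := 2 * (33 * r ^ 4 + r)) (i := i) hD0 hQ
        (fun N hN k hk n hn => le_mass_orbitLength_of_card_le φ hr hY hN hk hn) hκ E hpop hE
        (N := N) (hcard.trans (by
          calc ((i : ℝ) + 1) * (82944 * (r : ℝ) ^ 5) ≤ 33 * (r : ℝ) ^ 4 * (82944 * (r : ℝ) ^ 5) := by
                gcongr
            _ = _ := by ring)) (by omega)
      refine ⟨N', ?_, ?_⟩
      · push_cast; linarith
      · push_cast; linarith
  obtain ⟨N, -, hpot⟩ := hind _ le_rfl
  have h1 := potential_le φ χ ((Y : ℝ) ^ 2) N (33 * r ^ 4)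
  have h2 : ((33 * r ^ 4 : ℕ) : ℝ) * (1 / (16 * (r : ℝ) ^ 2)) = 33 / 16 * (r : ℝ) ^ 2 := by
    push_cast; field_simp
  rw [h2] at hpot
  nlinarith

lemma sq_card_le_card_monochromaticTriples (φ : G ≃+ G) (χ : G → Fin 1) :
    (Fintype.card G : ℝ) ^ 2 ≤ (monochromaticTriples φ χ).card := by
  have h : Fintype.card (G × G) ≤ (monochromaticTriples φ χ).card := by
    rw [← card_univ]
    refine card_le_card_of_injOn (fun a => (a.1, a.2 + φ a.1, a.2)) ?_ ?_
    · intro a _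
      simp [monochromaticTriples, eq_iff_true_of_subsingleton]
    · intro a _ b _ hab
      simp only [Prod.mk.injEq] at hab
      exact Prod.ext hab.1 hab.2.2
  rw [Fintype.card_prod] at h
  rw [pow_two]
  exact_mod_cast h

lemma exp_neg_pow_le {r : ℕ} (hr : 2 ≤ r) : Real.exp (-(r : ℝ) ^ 200) ≤
    (Real.exp (-(64 * 10 ^ 24 * (r : ℝ) ^ 35)) * (1 / (72 * (r : ℝ) ^ 2))) ^ 2 := by
  have hr2 : (2 : ℝ) ≤ r := by exact_mod_cast hr
  have hr1 : (1 : ℝ) ≤ r := by linarith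
  have h1 : Real.exp (-(72 * (r : ℝ) ^ 2)) ≤ 1 / (72 * (r : ℝ) ^ 2) := by
    rw [Real.exp_neg, ← one_div]
    apply one_div_le_one_div_of_le (by positivity)
    have := Real.add_one_le_exp (72 * (r : ℝ) ^ 2)
    linarith
  calc Real.exp (-(r : ℝ) ^ 200)
      ≤ (Real.exp (-(64 * 10 ^ 24 * (r : ℝ) ^ 35)) * Real.exp (-(72 * (r : ℝ) ^ 2))) ^ 2 := by
        rw [← Real.exp_add, ← Real.exp_nat_mul, Real.exp_le_exp]
        have h2 : (r : ℝ) ^ 2 ≤ (r : ℝ) ^ 35 := pow_le_pow_right₀ hr1 (by norm_num)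
        have h3 : (2 : ℝ) ^ 165 * (r : ℝ) ^ 35 ≤ (r : ℝ) ^ 200 := by
          calc (2 : ℝ) ^ 165 * (r : ℝ) ^ 35 ≤ (r : ℝ) ^ 165 * (r : ℝ) ^ 35 := by gcongr
            _ = _ := by rw [← pow_add]
        have h4 : (2 * (64 * 10 ^ 24 + 72) : ℝ) * (r : ℝ) ^ 35 ≤ 2 ^ 165 * (r : ℝ) ^ 35 := by
          gcongr; norm_num
        push_cast
        linarith
    _ ≤ _ := by gcongr

end

end LengthWeight

/-- There is an absolute constant `C > 0` such that: for any finite abelian group `G`,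
any automorphism `φ` of `G`, any `r ≥ 1` and any `r`-colouring `χ` of `G`, the number
of monochromatic triples `(x, y, z)` with `φ(x) = y - z` is at least
`exp(-r^C) · |G|²`. -/
theorem monochromatic_automorphism_triples :
    ∃ C : ℝ, 0 < C ∧
      ∀ (G : Type) [AddCommGroup G] [Fintype G] [DecidableEq G],
        ∀ (φ : G ≃+ G) (r : ℕ), 1 ≤ r → ∀ χ : G → Fin r,
          Real.exp (-(r : ℝ) ^ C) * (Fintype.card G : ℝ) ^ 2 ≤
            ((Finset.univ.filter fun t : G × G × G =>
                χ t.1 = χ t.2.1 ∧ χ t.1 = χ t.2.2 ∧ φ t.1 = t.2.1 - t.2.2).card : ℝ) := by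
  refine ⟨(200 : ℕ), by norm_num, fun G _ _ _ φ r hr χ => ?_⟩
  rw [Real.rpow_natCast]
  change _ ≤ ((LengthWeight.monochromaticTriples φ χ).card : ℝ)
  obtain rfl | hr2 : r = 1 ∨ 2 ≤ r := by omega
  · refine le_trans ?_ (LengthWeight.sq_card_le_card_monochromaticTriples φ χ)
    exact mul_le_of_le_one_left (by positivity) (Real.exp_le_one_iff.2 (by simp))
  · refine le_trans ?_ (LengthWeight.le_card_monochromaticTriples φ hr χ (by positivity) le_rfl)
    exact mul_le_mul_of_nonneg_right (LengthWeight.exp_neg_pow_le hr2) (by positivity)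
end

section
/- For every m, r, s ∈ ℕ* there is a number Ψ(m,r,s) ∈ ℕ* such that the following holds. Let 𝔽 be a finite field, let F ⊆ 𝔽 be a set with 0, 1 ∈ F and |F| ≤ s, let 𝔽* := 𝔽 \ {0} be r-coloured, let I be a finite index set with |I| ≥ Ψ(m,r,s), and let t ∈ 𝔽^I be F^{mr}-independent. Then there is t' ∈ 𝔽^m such that S(m,F;t') is monochromatic, i.e. S(m,F;t') is contained in a single colour class of the colouring of 𝔽* (in particular 0 ∉ S(m,F;t')). -/
/-- `DeuberS d F t = S(d, F; t) = ⋃_{j=1}^{d} (t_j + F·t_{j+1} + ⋯ + F·t_d)`. -/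
def DeuberS {𝔽 : Type*} [Field 𝔽] (d : ℕ) (F : Set 𝔽) (t : Fin d → 𝔽) : Set 𝔽 :=
  ⋃ j : Fin d,
    {x | ∃ f : Fin d → 𝔽, (∀ i : Fin d, j < i → f i ∈ F) ∧
      x = t j + ∑ i ∈ Finset.univ.filter fun i => j < i, f i * t i}

/-- Powers of a subset of a field: `F⁰ = {1}` and `F^{i+1} = F · Fⁱ`. -/
def SetPow {𝔽 : Type*} [Field 𝔽] (F : Set 𝔽) : ℕ → Set 𝔽
  | 0 => {1}
  | i + 1 => Set.image2 (· * ·) F (SetPow F i)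

/-- `t ∈ 𝔽^I` is `F`-independent if the only way to write `∑ᵢ fᵢ tᵢ = 0` with all
`fᵢ ∈ F` is with all `fᵢ = 0`. -/
def FIndep {𝔽 : Type*} [Field 𝔽] {I : Type*} [Fintype I] (F : Set 𝔽) (t : I → 𝔽) : Prop :=
  ∀ f : I → 𝔽, (∀ i, f i ∈ F) → ∑ i, f i * t i = 0 → ∀ i, f i = 0

/-- The Hales–Jewett theorem for linear combinations of a long tuple `t` with coefficients in a
small set `A`: there is a point `b` with a coordinate `1` and `n` nonempty disjoint blocks of
coordinates, given by `w`, such that varying the blocks over `A` does not change the colour. -/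
theorem exists_mono_linear_combinations (k n r : ℕ) :
    ∃ N : ℕ, ∀ (𝔽 : Type) [Field 𝔽] (A : Finset 𝔽), (0 : 𝔽) ∈ A → (1 : 𝔽) ∈ A → A.card ≤ k →
      ∀ (χ : 𝔽 → Fin r) (I : Type) [Fintype I], N ≤ Fintype.card I → ∀ t : I → 𝔽,
        ∃ (b : I → 𝔽) (w : I → Option (Fin n)), (∀ i, b i ∈ A) ∧
          (∃ i, b i = 1 ∧ w i = none) ∧ (∀ i, w i ≠ none → b i = 0) ∧
          (∀ j, ∃ i, w i = some j) ∧
          ∃ c, ∀ x : Fin n → 𝔽, (∀ j, x j ∈ A) →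
            χ (∑ i, (b i + (w i).elim 0 x) * t i) = c := by
  obtain ⟨N, hN⟩ := Combinatorics.Subspace.exists_mono_in_high_dimension_fin
    (Fin k) (Fin r) (Fin n)
  refine ⟨N + 1, fun 𝔽 _ A h0 h1 hA χ I _ hI t => ?_⟩
  obtain ⟨e⟩ : Nonempty (Option (Fin N) ↪ I) :=
    Function.Embedding.nonempty_of_card_le (by simpa using hI)
  obtain ⟨g, hgA, hg⟩ : ∃ g : Fin k → 𝔽, (∀ p, g p ∈ A) ∧ ∀ x ∈ A, ∃ p, g p = x := by
    obtain ⟨φ⟩ : Nonempty (A ↪ Fin k) :=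
      Function.Embedding.nonempty_of_card_le (by simpa using hA)
    have : Nonempty A := ⟨⟨0, h0⟩⟩
    refine ⟨fun p => (Function.invFun φ p : A), fun p => Subtype.coe_prop _, fun x hx => ?_⟩
    exact ⟨φ ⟨x, hx⟩, congrArg Subtype.val (Function.leftInverse_invFun φ.injective ⟨x, hx⟩)⟩
  obtain ⟨l, c, hl⟩ := hN fun v =>
    χ (∑ i, Function.extend e (fun o => o.elim 1 fun p => g (v p)) 0 i * t i)
  have he := e.injective
  refine ⟨Function.extend e (fun o => o.elim 1 fun p => (l.idxFun p).elim g 0) 0,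
    Function.extend e (fun o => o.elim none fun p => (l.idxFun p).elim (fun _ => none) some)
      (fun _ => none), ?_, ⟨e none, ?_, ?_⟩, ?_, ?_, c, ?_⟩
  · intro i
    by_cases hi : ∃ o, e o = i
    · obtain ⟨o, rfl⟩ := hi
      rw [he.extend_apply]
      rcases o with _ | p
      · simpa using h1
      · rcases h : l.idxFun p with q | q <;> simp [h, h0, hgA]
    · simpa [Function.extend_apply' _ _ _ hi] using h0
  · simp [he.extend_apply]
  · simp [he.extend_apply]
  · intro i
    by_cases hi : ∃ o, e o = i
    · obtain ⟨o, rfl⟩ := hi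
      rw [he.extend_apply, he.extend_apply]
      rcases o with _ | p
      · simp
      · rcases h : l.idxFun p with q | q <;> simp [h]
    · simp [Function.extend_apply' _ _ _ hi]
  · intro j
    obtain ⟨p, hp⟩ := l.proper j
    exact ⟨e (some p), by simp [he.extend_apply, hp]⟩
  · intro x hx
    choose y hy using fun j => hg (x j) (hx j)
    rw [← hl y]
    refine congrArg χ (Finset.sum_congr rfl fun i _ => congrArg (· * t i) ?_)
    by_cases hi : ∃ o, e o = i
    · obtain ⟨o, rfl⟩ := hi
      simp only [he.extend_apply]
      rcases o with _ | p
      · simp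
      · rcases h : l.idxFun p with q | q <;>
          simp [h, hy, Combinatorics.Subspace.apply_def]
    · simp [Function.extend_apply' _ _ _ hi]

section SetPow

variable {𝔽 : Type*} [Field 𝔽] {F : Set 𝔽}

theorem SetPow.subset_succ (h1 : (1 : 𝔽) ∈ F) (n : ℕ) : SetPow F n ⊆ SetPow F (n + 1) :=
  fun x hx => ⟨1, h1, x, hx, one_mul x⟩

theorem SetPow.one_mem (h1 : (1 : 𝔽) ∈ F) (n : ℕ) : (1 : 𝔽) ∈ SetPow F n := by
  induction n with
  | zero => rfl
  | succ n ih => exact SetPow.subset_succ h1 n ih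

theorem SetPow.zero_mem (h0 : (0 : 𝔽) ∈ F) (h1 : (1 : 𝔽) ∈ F) {n : ℕ} (hn : 0 < n) :
    (0 : 𝔽) ∈ SetPow F n := by
  obtain ⟨n, rfl⟩ := Nat.exists_eq_succ_of_ne_zero hn.ne'
  exact ⟨0, h0, 1, SetPow.one_mem h1 n, zero_mul 1⟩

theorem SetPow.exists_finset (F : Finset 𝔽) (n : ℕ) :
    ∃ A : Finset 𝔽, (A : Set 𝔽) = SetPow F n ∧ A.card ≤ F.card ^ n := by
  classical
  induction n with
  | zero => exact ⟨{1}, by simp [SetPow], by simp⟩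
  | succ n ih =>
    obtain ⟨A, hA, hc⟩ := ih
    refine ⟨Finset.image₂ (· * ·) F A, by simp [SetPow, ← hA], ?_⟩
    calc _ ≤ F.card * A.card := Finset.card_image₂_le _ _ _
      _ ≤ F.card ^ (n + 1) := by rw [pow_succ']; gcongr

end SetPow

/-- A long tuple `t` has `M` linear combinations, with coefficient vectors `a j`, such that each
set `t'_j + F t'_{j+1} + ⋯` formed from them is monochromatic, and all their `F`-combinations have
coefficients in `F ^ M ∪ {0}`. -/
theorem exists_mono_of_each_leading_index (M r s : ℕ) :
    ∃ N : ℕ, ∀ (𝔽 : Type) [Field 𝔽] (F : Finset 𝔽), (0 : 𝔽) ∈ F → (1 : 𝔽) ∈ F → F.card ≤ s →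
      ∀ (χ : 𝔽 → Fin r) (I : Type) [Fintype I], N ≤ Fintype.card I → ∀ t : I → 𝔽,
        ∃ a : Fin M → I → 𝔽,
          (∀ f : Fin M → 𝔽, (∀ j, f j ∈ F) →
            ∀ i, ∑ j, f j * a j i ∈ insert 0 (SetPow (F : Set 𝔽) M)) ∧
          ∀ j, ∃ c, ∀ f : Fin M → 𝔽, (∀ p, f p ∈ F) → f j = 1 → (∀ p < j, f p = 0) →
            (∃ i, ∑ p, f p * a p i = 1) ∧ χ (∑ i, (∑ p, f p * a p i) * t i) = c := by
  classical
  induction M with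
  | zero => exact ⟨0, fun _ _ _ _ _ _ _ _ _ _ _ => ⟨Fin.elim0, by simp, fun j => j.elim0⟩⟩
  | succ M ih =>
    obtain ⟨n, hn⟩ := ih
    obtain ⟨N, hN⟩ := exists_mono_linear_combinations (s ^ M + 1) n r
    refine ⟨N, fun 𝔽 _ F h0 h1 hF χ I _ hI t => ?_⟩
    obtain ⟨A, hA, hAc⟩ := SetPow.exists_finset F M
    have h1A : (1 : 𝔽) ∈ A := by
      rw [← Finset.mem_coe, hA]
      exact SetPow.one_mem h1 M
    obtain ⟨b, w, hbA, ⟨i₀, hbi₀, hwi₀⟩, hbw, hw, c, hc⟩ := hN 𝔽 (insert 0 A)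
      (Finset.mem_insert_self _ _) (Finset.mem_insert_of_mem h1A)
      ((Finset.card_insert_le _ _).trans
        (Nat.succ_le_succ (hAc.trans (Nat.pow_le_pow_left hF M)))) χ I hI t
    obtain ⟨a, ha, hmono⟩ := hn 𝔽 F h0 h1 hF χ (Fin n) (by simp)
      (fun k => ∑ i, if w i = some k then t i else 0)
    have hsum : ∀ (f : Fin (M + 1) → 𝔽) (i : I),
        ∑ j, f j * (Fin.cons b (fun j i => (w i).elim 0 (a j)) : Fin (M + 1) → I → 𝔽) j i
          = f 0 * b i + (w i).elim 0 fun k => ∑ j : Fin M, f j.succ * a j k := by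
      intro f i
      rw [Fin.sum_univ_succ]
      cases h : w i <;> simp [h]
    have hblock : ∀ x : Fin n → 𝔽, ∑ i, (w i).elim 0 x * t i
        = ∑ k, x k * ∑ i, if w i = some k then t i else 0 := by
      intro x
      simp_rw [Finset.mul_sum]
      rw [Finset.sum_comm]
      refine Finset.sum_congr rfl fun i _ => ?_
      cases h : w i <;> simp
    have hsub : ∀ x ∈ insert 0 (SetPow (F : Set 𝔽) M),
        x ∈ insert 0 (SetPow (F : Set 𝔽) (M + 1)) :=
      fun x hx => Set.insert_subset_insert (SetPow.subset_succ h1 M) hx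
    refine ⟨Fin.cons b fun j i => (w i).elim 0 (a j), fun f hf i => ?_, fun j => ?_⟩
    · rw [hsum]
      cases h : w i with
      | none =>
        have hb := hbA i
        rw [← Finset.mem_coe, Finset.coe_insert, hA] at hb
        rcases hb with hb | hb
        · simp [hb]
        · exact Or.inr (by simpa using ⟨f 0, hf 0, b i, hb, rfl⟩)
      | some k =>
        rw [hbw i (by simp [h])]
        simpa using hsub _ (ha (fun j => f j.succ) (fun j => hf _) k)
    · simp_rw [hsum]
      cases j using Fin.cases with
      | zero =>
        refine ⟨c, fun f hf hf1 _ => ⟨⟨i₀, by simp [hf1, hbi₀, hwi₀]⟩, ?_⟩⟩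
        simp_rw [hf1, one_mul]
        refine hc _ fun k => ?_
        rw [← Finset.mem_coe, Finset.coe_insert, hA]
        exact ha (fun j => f j.succ) (fun j => hf _) k
      | succ j =>
        obtain ⟨d, hd⟩ := hmono j
        refine ⟨d, fun f hf hf1 hf0 => ?_⟩
        obtain ⟨⟨k, hk⟩, hχ⟩ := hd (fun j => f j.succ) (fun j => hf _) hf1
          fun p hp => hf0 _ (Fin.succ_lt_succ_iff.2 hp)
        obtain ⟨i, hi⟩ := hw k
        have hz : f 0 = 0 := hf0 0 (Fin.succ_pos j)
        refine ⟨⟨i, by simp [hz, hi, hk]⟩, ?_⟩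
        simp_rw [hz, zero_mul, zero_add]
        rw [hblock, hχ]

/-- For every `m, r, s ≥ 1` there is `Ψ(m,r,s) ≥ 1` such that: if `𝔽` is a finite field,
`F ⊆ 𝔽` has `0, 1 ∈ F` and `|F| ≤ s`, `𝔽*` is `r`-coloured, `|I| ≥ Ψ(m,r,s)`, and
`t ∈ 𝔽^I` is `F^{mr}`-independent, then there is `t' ∈ 𝔽^m` with `S(m,F;t')`
monochromatic (in particular avoiding `0`). -/
theorem deuber_for_S_sets (m r s : ℕ) (hm : 0 < m) (hr : 0 < r) (hs : 0 < s) :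
    ∃ Ψ : ℕ, 0 < Ψ ∧
      ∀ (𝔽 : Type) [Field 𝔽] [Fintype 𝔽] (F : Finset 𝔽),
        (0 : 𝔽) ∈ F → (1 : 𝔽) ∈ F → F.card ≤ s →
        ∀ χ : 𝔽 → Fin r,
        ∀ (I : Type) [Fintype I], Ψ ≤ Fintype.card I →
        ∀ t : I → 𝔽, FIndep (SetPow (↑F) (m * r)) t →
          ∃ t' : Fin m → 𝔽, (∀ x ∈ DeuberS m (↑F) t', x ≠ 0) ∧
            ∃ c : Fin r, ∀ x ∈ DeuberS m (↑F) t', χ x = c := by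
  obtain ⟨N, hN⟩ := exists_mono_of_each_leading_index (m * r) r s
  refine ⟨N + 1, N.succ_pos, fun 𝔽 _ _ F h0 h1 hF χ I _ hI t ht => ?_⟩
  obtain ⟨a, ha, hmono⟩ := hN 𝔽 F h0 h1 hF χ I (by omega) t
  choose col hcol using hmono
  have : Nonempty (Fin r) := ⟨⟨0, hr⟩⟩
  obtain ⟨c, hc⟩ := Fintype.exists_le_card_fiber_of_mul_le_card (n := m) col
    (by simp [mul_comm])
  let ψ := Finset.orderEmbOfCardLe _ hc
  have hψ : ∀ p, col (ψ p) = c := fun p =>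
    (Finset.mem_filter.1 (Finset.orderEmbOfCardLe_mem _ hc p)).2
  have key : ∀ x ∈ DeuberS m (F : Set 𝔽) (fun p => ∑ i, a (ψ p) i * t i),
      x ≠ 0 ∧ χ x = c := by
    intro x hx
    obtain ⟨j, f, hf, rfl⟩ := Set.mem_iUnion.1 hx
    let h : Fin m → 𝔽 := fun p => if p = j then 1 else if j < p then f p else 0
    let g : Fin (m * r) → 𝔽 := Function.extend ψ h 0
    have hg_apply : ∀ p, g (ψ p) = h p := fun p => ψ.injective.extend_apply _ _ _
    have hg_zero : ∀ q, (¬ ∃ p, ψ p = q) → g q = 0 := fun q hq => Function.extend_apply' _ _ _ hq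
    have hg_mem : ∀ q, g q ∈ F := by
      intro q
      by_cases hq : ∃ p, ψ p = q
      · obtain ⟨p, rfl⟩ := hq
        rw [hg_apply]
        dsimp only [h]
        split_ifs with h2 h3
        exacts [h1, hf p h3, h0]
      · rwa [hg_zero q hq]
    have hlead : ∀ q < ψ j, g q = 0 := by
      intro q hq
      by_cases hqr : ∃ p, ψ p = q
      · obtain ⟨p, rfl⟩ := hqr
        have hp : p < j := ψ.lt_iff_lt.1 hq
        simp [hg_apply, h, hp.ne, hp.not_gt]
      · exact hg_zero q hqr
    have hsum : ∀ i, ∑ q, g q * a q i = ∑ p, h p * a (ψ p) i := by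
      intro i
      symm
      refine Finset.sum_of_injOn ψ ψ.injective.injOn (by simp) (fun q _ hq => ?_)
        fun p _ => by rw [hg_apply]
      rw [hg_zero q (by simpa using hq), zero_mul]
    have hx : ∑ i, (∑ q, g q * a q i) * t i = (∑ i, a (ψ j) i * t i) +
        ∑ p ∈ Finset.univ.filter (fun p => j < p), f p * ∑ i, a (ψ p) i * t i := by
      have hsplit : ∀ p, h p * ∑ i, a (ψ p) i * t i =
          (if p = j then ∑ i, a (ψ p) i * t i else 0) +
            if j < p then f p * ∑ i, a (ψ p) i * t i else 0 := by
        intro p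
        dsimp only [h]
        split_ifs with h2 h3 h3
        · exact absurd h2 h3.ne'
        all_goals simp
      calc _ = ∑ p, h p * ∑ i, a (ψ p) i * t i := by
            simp_rw [hsum, Finset.sum_mul, Finset.mul_sum, mul_assoc]
            exact Finset.sum_comm
        _ = _ := by
            simp_rw [hsplit, Finset.sum_add_distrib, Finset.sum_filter]
            simp
    obtain ⟨⟨i, hi⟩, hχ⟩ := hcol (ψ j) g hg_mem (by simp [hg_apply, h]) hlead
    rw [← hx]
    refine ⟨fun hzero => ?_, hχ.trans (hψ j)⟩
    have hmem := ha g hg_mem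
    rw [Set.insert_eq_of_mem (SetPow.zero_mem h0 h1 (Nat.mul_pos hm hr))] at hmem
    exact one_ne_zero (hi.symm.trans (ht _ hmem hzero i))
  exact ⟨_, fun x hx => (key x hx).1, c, fun x hx => (key x hx).2⟩
end

section
/- Let a ≥ 2 be an integer and set N := a² + 3a. Then for every 2-colouring of {1, 2, …, N} there exist x, y, z ∈ {1, …, N}, all of the same colour, with ax + y ≡ z (mod N+1). Consequently, since f_a(2) = a² + 3a, the modular Rado number h_a(2) is strictly smaller than f_a(2) for every a > 1. -/
/-- For every integer `a ≥ 2`, setting `N = a² + 3a`, every `2`-colouring of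
`{1, …, N}` admits a monochromatic triple `(x, y, z)` with
`a·x + y ≡ z (mod N + 1)`. -/
theorem two_colouring_modular_solution (a : ℕ) (ha : 2 ≤ a) (χ : ℕ → Fin 2) :
    ∃ x ∈ Finset.Icc 1 (a ^ 2 + 3 * a), ∃ y ∈ Finset.Icc 1 (a ^ 2 + 3 * a),
      ∃ z ∈ Finset.Icc 1 (a ^ 2 + 3 * a),
        χ x = χ y ∧ χ x = χ z ∧ a * x + y ≡ z [MOD a ^ 2 + 3 * a + 1] := by
  by_contra hno
  have forbid (x y z t : ℕ) (hx : 1 ≤ x ∧ x ≤ a ^ 2 + 3 * a) (hy : 1 ≤ y ∧ y ≤ a ^ 2 + 3 * a)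
      (hz : 1 ≤ z ∧ z ≤ a ^ 2 + 3 * a) (h : a * x + y = z + (a ^ 2 + 3 * a + 1) * t) :
      ¬(χ x = χ y ∧ χ x = χ z) := fun hc =>
    hno ⟨x, Finset.mem_Icc.2 hx, y, Finset.mem_Icc.2 hy, z, Finset.mem_Icc.2 hz, hc.1, hc.2,
      by rw [h]; simp [Nat.ModEq]⟩
  have hsq : 2 * a ≤ a ^ 2 := by nlinarith
  -- Since `(a + 1) * (a + 2) ≡ 1` and `(a + 2) ^ 2 ≡ a + 3`, the elements `k` and `(a + 3) * k`
  -- share a colour.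
  have h₁ := forbid (a + 2) (a + 2) 1 1 (by omega) (by omega) (by omega) (by ring)
  have h₂ := forbid (a + 3) (a + 3) (a + 2) 1 (by omega) (by omega) (by omega) (by ring)
  have h₃ := forbid (2 * a + 4) (2 * a + 4) 2 2 (by omega) (by omega) (by omega) (by ring)
  have h₄ := forbid (2 * a + 6) (2 * a + 6) (2 * a + 4) 2 (by omega) (by omega) (by omega)
    (by ring)
  -- Since `a * (a + 3) ≡ -1`, it follows that `k + w = y` has no monochromatic solution, which
  -- already fails on `{1, …, 5}`.
  have s₁ := forbid (a + 3) 2 1 1 (by omega) (by omega) (by omega) (by ring)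
  have s₂ := forbid (2 * a + 6) 4 2 2 (by omega) (by omega) (by omega) (by ring)
  have s₃ := forbid (a + 3) 4 3 1 (by omega) (by omega) (by omega) (by ring)
  have s₄ := forbid (a + 3) 5 4 1 (by omega) (by omega) (by omega) (by ring)
  have s₅ := forbid (2 * a + 6) 5 3 2 (by omega) (by omega) (by omega) (by ring)
  omega
end

section
/- There is an absolute constant C > 0 such that the following holds. Let n, r ≥ 1 and let χ be an r-colouring of the finite field 𝔽_{2^n} with 2^n elements. Then the number of triples (x, y, z) ∈ 𝔽_{2^n}³ with χ(x) = χ(y) = χ(z) and x² = y + z is at least exp(−r^C)·4^n. -/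
namespace SquareTriples

open Finset
open scoped Classical

section Fourier

variable {G : Type*} [AddCommGroup G]

/-- The kernel of an additive character. -/
def charKer (ψ : AddChar G ℂ) : AddSubgroup G where
  carrier := {x | ψ x = 1}
  zero_mem' := ψ.map_zero_eq_one
  add_mem' := by
    intro a b ha hb
    simp only [Set.mem_ofPred_eq] at *
    rw [ψ.map_add_eq_mul, ha, hb, one_mul]
  neg_mem' := by
    intro a ha
    simp only [Set.mem_ofPred_eq] at *
    rw [ψ.map_neg_eq_inv, ha, inv_one]

lemma mem_charKer {ψ : AddChar G ℂ} {x : G} : x ∈ charKer ψ ↔ ψ x = 1 := Iff.rfl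

lemma char_eq_one_or_neg_one (h2 : ∀ x : G, x + x = 0) (ψ : AddChar G ℂ) (x : G) :
    ψ x = 1 ∨ ψ x = -1 := by
  have h : ψ x * ψ x = 1 := by rw [← ψ.map_add_eq_mul, h2, ψ.map_zero_eq_one]
  exact mul_self_eq_one_iff.mp h

lemma re_char_add (h2 : ∀ x : G, x + x = 0) (ψ : AddChar G ℂ) (x y : G) :
    (ψ (x + y)).re = (ψ x).re * (ψ y).re := by
  rw [ψ.map_add_eq_mul]
  rcases char_eq_one_or_neg_one h2 ψ x with h | h <;>
    rcases char_eq_one_or_neg_one h2 ψ y with h' | h' <;> simp [h, h']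

lemma index_charKer_le_two (h2 : ∀ x : G, x + x = 0) (ψ : AddChar G ℂ) :
    (charKer ψ).index ≤ 2 := by
  by_cases h : ∃ a, ψ a = -1
  · obtain ⟨a, ha⟩ := h
    refine (AddSubgroup.index_eq_two_iff.mpr ⟨a, fun b => ?_⟩).le
    simp only [mem_charKer, ψ.map_add_eq_mul, ha]
    rcases char_eq_one_or_neg_one h2 ψ b with hb | hb <;> rw [hb] <;> norm_num [Xor]
  · have : charKer ψ = ⊤ := by
      ext x
      simp only [mem_charKer, AddSubgroup.mem_top, iff_true]
      exact (char_eq_one_or_neg_one h2 ψ x).resolve_right fun hx => h ⟨x, hx⟩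
    rw [this, AddSubgroup.index_top]
    norm_num

/-- The (unnormalised) Fourier coefficient of a finite set, as a real number. -/
noncomputable def charSum (ψ : AddChar G ℂ) (A : Finset G) : ℝ := ∑ a ∈ A, (ψ a).re

lemma exists_char_eq_neg_one (h2 : ∀ x : G, x + x = 0) {ψ : AddChar G ℂ} {V : AddSubgroup G}
    (hψ : ¬ V ≤ charKer ψ) : ∃ v ∈ V, ψ v = -1 := by
  obtain ⟨v, hv, hn⟩ := SetLike.not_le_iff_exists.mp hψ
  exact ⟨v, hv, (char_eq_one_or_neg_one h2 ψ v).resolve_left hn⟩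

lemma charSum_of_le_charKer {ψ : AddChar G ℂ} {V : AddSubgroup G} (hψ : V ≤ charKer ψ)
    {A : Finset G} (hA : ∀ a ∈ A, a ∈ V) : charSum ψ A = #A := by
  rw [charSum, sum_congr rfl fun a ha => by rw [mem_charKer.mp (hψ (hA a ha))]]
  simp

variable [Fintype G]

lemma sum_re_char (x : G) :
    ∑ ψ : AddChar G ℂ, (ψ x).re = if x = 0 then (Fintype.card G : ℝ) else 0 := by
  have h := congrArg Complex.re (AddChar.sum_apply_eq_ite x)
  rw [Complex.re_sum] at h
  rw [h]
  split_ifs <;> simp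

lemma sum_charSum_sq_mul (h2 : ∀ x : G, x + x = 0) (A B : Finset G) :
    ∑ ψ : AddChar G ℂ, charSum ψ A ^ 2 * charSum ψ B =
      Fintype.card G * #{t ∈ A ×ˢ A ×ˢ B | t.1 + t.2.1 = t.2.2} := by
  have h : ∀ ψ : AddChar G ℂ, charSum ψ A ^ 2 * charSum ψ B =
      ∑ t ∈ A ×ˢ A ×ˢ B, (ψ (t.1 + (t.2.1 + t.2.2))).re := by
    intro ψ
    simp only [charSum, re_char_add h2, sum_product, ← mul_sum, ← sum_mul]
    ring
  simp only [h]
  rw [sum_comm]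
  simp only [sum_re_char]
  rw [← sum_filter, sum_const, nsmul_eq_mul, mul_comm]
  congr 3
  refine filter_congr fun t _ => ?_
  rw [← add_assoc, add_eq_zero_iff_eq_neg, neg_eq_of_add_eq_zero_left (h2 t.2.2)]

lemma sum_charSum_sq (h2 : ∀ x : G, x + x = 0) (A : Finset G) :
    ∑ ψ : AddChar G ℂ, charSum ψ A ^ 2 = Fintype.card G * #A := by
  have h : ∀ ψ : AddChar G ℂ, charSum ψ A ^ 2 =
      ∑ a ∈ A, ∑ b ∈ A, (ψ (a + b)).re := by
    intro ψ
    simp only [charSum, re_char_add h2, ← mul_sum, ← sum_mul]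
    ring
  simp only [h]
  rw [sum_comm]
  have h' : ∀ a ∈ A, ∑ ψ : AddChar G ℂ, ∑ b ∈ A, (ψ (a + b)).re = Fintype.card G := by
    intro a ha
    rw [sum_comm]
    simp only [sum_re_char]
    rw [sum_eq_single_of_mem a ha]
    · simp [h2]
    · intro b _ hb
      rw [if_neg]
      rw [add_eq_zero_iff_eq_neg, neg_eq_of_add_eq_zero_left (h2 b)]
      exact hb.symm
  rw [sum_congr rfl h', sum_const, nsmul_eq_mul, mul_comm]

/-- Splitting a sum over a subgroup along the kernel of a character. -/
lemma sum_subgroup_split (h2 : ∀ x : G, x + x = 0) (ψ : AddChar G ℂ) (V : AddSubgroup G)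
    {v : G} (hv : v ∈ V) (hψ : ψ v = -1) (f : G → ℝ) :
    ∑ x with x ∈ V, f x =
      ∑ x with x ∈ V ⊓ charKer ψ, f x + ∑ x with x ∈ V ⊓ charKer ψ, f (v + x) := by
  rw [← sum_filter_add_sum_filter_not (univ.filter (· ∈ V)) (fun x => ψ x = 1) f,
    filter_filter, filter_filter]
  congr 1
  · simp only [AddSubgroup.mem_inf, mem_charKer]
  refine sum_nbij' (fun x => v + x) (fun x => v + x) ?_ ?_ ?_ ?_ ?_
  · intro x hx
    simp only [mem_filter, mem_univ, true_and, AddSubgroup.mem_inf, mem_charKer] at hx ⊢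
    refine ⟨V.add_mem hv hx.1, ?_⟩
    rw [ψ.map_add_eq_mul, hψ, (char_eq_one_or_neg_one h2 ψ x).resolve_left hx.2]
    norm_num
  · intro x hx
    simp only [mem_filter, mem_univ, true_and, AddSubgroup.mem_inf, mem_charKer] at hx ⊢
    refine ⟨V.add_mem hv hx.1, ?_⟩
    rw [ψ.map_add_eq_mul, hψ, hx.2]
    norm_num
  · intro x _
    rw [← add_assoc, h2, zero_add]
  · intro x _
    rw [← add_assoc, h2, zero_add]
  · intro x _
    rw [← add_assoc, h2, zero_add]

lemma card_filter_mem (V : AddSubgroup G) : #{x | x ∈ V} = Nat.card V := by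
  rw [Nat.card_eq_fintype_card, Fintype.card_subtype]

/-- The annihilator of `V` has `|G| / |V|` elements. -/
lemma card_annihilator_mul (h2 : ∀ x : G, x + x = 0) (V : AddSubgroup G) :
    (#{ψ : AddChar G ℂ | V ≤ charKer ψ} : ℝ) * Nat.card V = Fintype.card G := by
  have h1 : ∑ ψ : AddChar G ℂ, charSum ψ {x | x ∈ V} = Fintype.card G := by
    simp only [charSum]
    rw [sum_comm]
    simp only [sum_re_char]
    rw [sum_eq_single_of_mem 0 (by simp [V.zero_mem])]
    · simp
    · intro b _ hb
      simp [hb]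
  rw [← h1, ← sum_filter_add_sum_filter_not univ (fun ψ : AddChar G ℂ => V ≤ charKer ψ)]
  rw [sum_congr rfl fun ψ hψ => charSum_of_le_charKer (mem_filter.mp hψ).2
    (A := {x | x ∈ V}) (by simp)]
  rw [sum_const, nsmul_eq_mul, card_filter_mem, left_eq_add]
  refine sum_eq_zero fun ψ hψ => ?_
  obtain ⟨v, hv, hψv⟩ := exists_char_eq_neg_one h2 (mem_filter.mp hψ).2
  rw [charSum, sum_subgroup_split h2 ψ V hv hψv, ← sum_add_distrib]
  refine sum_eq_zero fun x _ => ?_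
  rw [re_char_add h2, hψv]
  simp

/-- If the nontrivial Fourier coefficients of `A ⊆ V` are small, then `A + A` hits every dense
subset of `V` often. -/
lemma card_add_mem_ge (h2 : ∀ x : G, x + x = 0) (V : AddSubgroup G) {A B : Finset G}
    (hA : ∀ a ∈ A, a ∈ V) (hB : ∀ b ∈ B, b ∈ V) {η : ℝ} (hη : 0 ≤ η)
    (hbias : ∀ ψ : AddChar G ℂ, ¬ V ≤ charKer ψ → |charSum ψ A| ≤ η * Nat.card V) :
    (#A : ℝ) ^ 2 * #B ≤ Nat.card V * #{t ∈ A ×ˢ A ×ˢ B | t.1 + t.2.1 = t.2.2}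
      + η * (Nat.card V : ℝ) ^ 3 := by
  have hVpos : (0 : ℝ) < Nat.card V := by exact_mod_cast Nat.card_pos
  have hGpos : (0 : ℝ) < Fintype.card G := by exact_mod_cast Fintype.card_pos
  have hAV : (#A : ℝ) ≤ Nat.card V := by
    rw [← card_filter_mem]
    exact_mod_cast card_le_card fun a ha => by simpa using hA a ha
  have hBV : (#B : ℝ) ≤ Nat.card V := by
    rw [← card_filter_mem]
    exact_mod_cast card_le_card fun a ha => by simpa using hB a ha
  have key := sum_charSum_sq_mul h2 A B
  rw [← sum_filter_add_sum_filter_not univ (fun ψ : AddChar G ℂ => V ≤ charKer ψ)] at key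
  rw [sum_congr rfl fun ψ hψ => by
    rw [charSum_of_le_charKer (mem_filter.mp hψ).2 hA,
      charSum_of_le_charKer (mem_filter.mp hψ).2 hB], sum_const, nsmul_eq_mul] at key
  have hrest : -(η * Nat.card V * (Fintype.card G * Nat.card V)) ≤
      ∑ ψ : AddChar G ℂ with ¬ V ≤ charKer ψ, charSum ψ A ^ 2 * charSum ψ B := by
    calc -(η * Nat.card V * (Fintype.card G * Nat.card V))
        ≤ -(η * Nat.card V * ((Fintype.card G * #A + Fintype.card G * #B) / 2)) := by
          gcongr
          nlinarith
      _ = -(η * Nat.card V * ∑ ψ : AddChar G ℂ, (charSum ψ A ^ 2 + charSum ψ B ^ 2) / 2) := by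
          rw [← sum_div, sum_add_distrib, sum_charSum_sq h2, sum_charSum_sq h2]
      _ ≤ -(η * Nat.card V * ∑ ψ : AddChar G ℂ with ¬ V ≤ charKer ψ,
            (charSum ψ A ^ 2 + charSum ψ B ^ 2) / 2) := by
          refine neg_le_neg (mul_le_mul_of_nonneg_left ?_ (by positivity))
          exact sum_le_sum_of_subset_of_nonneg (filter_subset _ _) fun _ _ _ => by positivity
      _ ≤ _ := by
          rw [mul_sum, ← sum_neg_distrib]
          refine sum_le_sum fun ψ hψ => ?_
          have hb := hbias ψ (mem_filter.mp hψ).2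
          refine neg_le_of_abs_le ?_
          calc |charSum ψ A ^ 2 * charSum ψ B|
              = |charSum ψ A| * (|charSum ψ A| * |charSum ψ B|) := by
                rw [abs_mul, abs_pow]; ring
            _ ≤ _ := by
                gcongr
                nlinarith [sq_nonneg (|charSum ψ A| - |charSum ψ B|), sq_abs (charSum ψ A),
                  sq_abs (charSum ψ B)]
  have hT := card_annihilator_mul h2 V
  set T : ℝ := (#{ψ : AddChar G ℂ | V ≤ charKer ψ} : ℝ)
  have hTpos : 0 < T := by
    by_contra h
    nlinarith
  rw [← hT] at key hrest
  refine le_of_mul_le_mul_left ?_ hTpos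
  nlinarith

end Fourier

section IterInf

variable {G : Type*} [AddCommGroup G]

/-- The intersection `U ⊓ φ⁻¹ U ⊓ ⋯ ⊓ φ⁻ᵏ U`. -/
def iterInf (φ : G →+ G) (U : AddSubgroup G) : ℕ → AddSubgroup G
  | 0 => U
  | k + 1 => U ⊓ (iterInf φ U k).comap φ

lemma iterInf_mono (φ : G →+ G) {U U' : AddSubgroup G} (h : U ≤ U') (k : ℕ) :
    iterInf φ U k ≤ iterInf φ U' k := by
  induction k with
  | zero => exact h
  | succ k ih => exact inf_le_inf h (AddSubgroup.comap_mono ih)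

lemma iterInf_succ_le (φ : G →+ G) (U : AddSubgroup G) (k : ℕ) :
    iterInf φ U (k + 1) ≤ iterInf φ U k := by
  induction k with
  | zero => exact inf_le_left
  | succ k ih => exact inf_le_inf le_rfl (AddSubgroup.comap_mono ih)

lemma iterInf_le (φ : G →+ G) (U : AddSubgroup G) (k : ℕ) : iterInf φ U k ≤ U := by
  cases k with
  | zero => exact le_rfl
  | succ k => exact inf_le_left

lemma index_iterInf_le {φ : G →+ G} (hφ : Function.Surjective φ) (U : AddSubgroup G) (k : ℕ) :
    (iterInf φ U k).index ≤ U.index ^ (k + 1) := by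
  induction k with
  | zero => simp [iterInf]
  | succ k ih =>
    calc (U ⊓ (iterInf φ U k).comap φ).index
        ≤ U.index * ((iterInf φ U k).comap φ).index := AddSubgroup.index_inf_le
      _ = U.index * (iterInf φ U k).index := by rw [AddSubgroup.index_comap_of_surjective _ hφ]
      _ ≤ U.index * U.index ^ (k + 1) := by gcongr
      _ = U.index ^ (k + 1 + 1) := by ring

end IterInf

section Increment

variable {G : Type*} [AddCommGroup G] [Fintype G]

/-- The number of points of `S` in the coset `c + V`. -/
noncomputable def cosetCount (S : Finset G) (V : AddSubgroup G) (c : G) : ℕ :=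
  #{v | v ∈ V ∧ c + v ∈ S}

/-- The largest density of `S` on a coset of `V`, rounded down to a multiple of `1 / M` and
measured in units of `1 / M`. -/
noncomputable def level (M : ℕ) (S : Finset G) (V : AddSubgroup G) : ℕ :=
  univ.sup fun c => M * cosetCount S V c / Nat.card V

lemma le_level (M : ℕ) (S : Finset G) (V : AddSubgroup G) (c : G) :
    M * cosetCount S V c / Nat.card V ≤ level M S V :=
  le_sup (f := fun c => M * cosetCount S V c / Nat.card V) (mem_univ c)

lemma exists_level_eq (M : ℕ) (S : Finset G) (V : AddSubgroup G) :
    ∃ c, level M S V = M * cosetCount S V c / Nat.card V := by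
  obtain ⟨c, -, hc⟩ := exists_mem_eq_sup (univ : Finset G) univ_nonempty
    fun c => M * cosetCount S V c / Nat.card V
  exact ⟨c, hc⟩

lemma cosetCount_le_card (S : Finset G) (V : AddSubgroup G) (c : G) :
    cosetCount S V c ≤ Nat.card V := by
  rw [← card_filter_mem]
  exact card_le_card fun x hx => by
    simp only [mem_filter, mem_univ, true_and] at hx ⊢
    exact hx.1

lemma level_le (M : ℕ) (S : Finset G) (V : AddSubgroup G) : level M S V ≤ M := by
  refine Finset.sup_le fun c _ => Nat.div_le_of_le_mul ?_
  rw [mul_comm]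
  exact Nat.mul_le_mul_right _ (cosetCount_le_card S V c)

lemma sum_cosetCount (S : Finset G) {V W : AddSubgroup G} (hW : W ≤ V) (c : G) :
    ∑ v with v ∈ V, cosetCount S W (c + v) = Nat.card W * cosetCount S V c := by
  have h : ∀ v, cosetCount S W (c + v) = ∑ w with w ∈ W, if c + (w + v) ∈ S then 1 else 0 := by
    intro v
    rw [cosetCount, ← filter_filter, card_filter]
    refine sum_congr rfl fun w _ => ?_
    rw [add_assoc, add_comm v w]
  simp only [h]
  rw [sum_comm, ← card_filter_mem W, ← smul_eq_mul, ← sum_const]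
  refine sum_congr rfl fun w hw => ?_
  have hwV : w ∈ V := hW (mem_filter.mp hw).2
  rw [cosetCount, ← filter_filter, card_filter]
  refine sum_nbij' (fun v => w + v) (fun v => -w + v) ?_ ?_ ?_ ?_ ?_
  · intro v hv
    simp only [mem_filter, mem_univ, true_and] at hv ⊢
    exact V.add_mem hwV hv
  · intro v hv
    simp only [mem_filter, mem_univ, true_and] at hv ⊢
    exact V.add_mem (V.neg_mem hwV) hv
  · intro v _
    simp
  · intro v _
    simp
  · intro v _
    rfl

lemma level_anti (M : ℕ) (S : Finset G) {V W : AddSubgroup G} (hW : W ≤ V) :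
    level M S V ≤ level M S W := by
  obtain ⟨c, hc⟩ := exists_level_eq M S V
  have hVpos : 0 < Nat.card V := Nat.card_pos
  have hWpos : 0 < Nat.card W := Nat.card_pos
  obtain ⟨v, -, hv⟩ : ∃ v ∈ ({v | v ∈ V} : Finset G),
      Nat.card W * cosetCount S V c ≤ Nat.card V * cosetCount S W (c + v) := by
    refine exists_le_of_sum_le ⟨0, by simp [V.zero_mem]⟩ ?_
    rw [sum_const, card_filter_mem, ← mul_sum, sum_cosetCount S hW, smul_eq_mul]
  refine hc.le.trans (le_trans ?_ (le_level M S W (c + v)))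
  rw [Nat.le_div_iff_mul_le hWpos]
  refine Nat.le_of_mul_le_mul_left ?_ hVpos
  calc Nat.card V * (M * cosetCount S V c / Nat.card V * Nat.card W)
      = (M * cosetCount S V c / Nat.card V * Nat.card V) * Nat.card W := by ring
    _ ≤ (M * cosetCount S V c) * Nat.card W := Nat.mul_le_mul_right _ (Nat.div_mul_le_self _ _)
    _ = M * (Nat.card W * cosetCount S V c) := by ring
    _ ≤ M * (Nat.card V * cosetCount S W (c + v)) := by gcongr
    _ = _ := by ring

/-- A set whose densest coset cannot be improved on a subgroup of index two is unbiased there. -/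
lemma abs_charSum_coset_le (h2 : ∀ x : G, x + x = 0) {M : ℕ} (hM : 0 < M) (S : Finset G)
    (V : AddSubgroup G) {ψ : AddChar G ℂ} (hψ : ¬ V ≤ charKer ψ) {c : G}
    (hlev : level M S (V ⊓ charKer ψ) ≤ M * cosetCount S V c / Nat.card V) :
    |charSum ψ {v | v ∈ V ∧ c + v ∈ S}| ≤ 1 / M * Nat.card V := by
  obtain ⟨v, hv, hψv⟩ := exists_char_eq_neg_one h2 hψ
  set W := V ⊓ charKer ψ with hW
  set l := M * cosetCount S V c / Nat.card V with hl
  have hMpos : (0 : ℝ) < M := by exact_mod_cast hM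
  have hup : ∀ d, (M : ℝ) * cosetCount S W d ≤ (l + 1) * Nat.card W := by
    intro d
    have h := Nat.lt_succ_of_le ((le_level M S W d).trans hlev)
    rw [Nat.div_lt_iff_lt_mul Nat.card_pos] at h
    exact_mod_cast h.le
  have hlow : (l : ℝ) * Nat.card V ≤ M * cosetCount S V c := by
    exact_mod_cast Nat.div_mul_le_self _ _
  have hcast : ∀ (U : AddSubgroup G) (d : G),
      (cosetCount S U d : ℝ) = ∑ x with x ∈ U, if d + x ∈ S then 1 else 0 := by
    intro U d
    rw [cosetCount, ← filter_filter, card_filter]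
    push_cast
    rfl
  have hcard : (Nat.card V : ℝ) = 2 * Nat.card W := by
    have h := sum_subgroup_split h2 ψ V hv hψv fun _ => 1
    simp only [sum_const, nsmul_eq_mul, mul_one, card_filter_mem] at h
    rw [h, two_mul]
  have hsum : (cosetCount S V c : ℝ) = cosetCount S W c + cosetCount S W (c + v) := by
    rw [hcast, hcast, hcast, sum_subgroup_split h2 ψ V hv hψv]
    simp only [add_assoc, hW]
  have hdiff : charSum ψ {v | v ∈ V ∧ c + v ∈ S} =
      (cosetCount S W c : ℝ) - cosetCount S W (c + v) := by
    rw [charSum, ← filter_filter, sum_filter, hcast, hcast,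
      sum_subgroup_split h2 ψ V hv hψv, sub_eq_add_neg, ← sum_neg_distrib]
    congr 1
    · refine sum_congr rfl fun x hx => ?_
      have hx1 : ψ x = 1 := (mem_filter.mp hx).2.2
      simp [hx1]
    · refine sum_congr rfl fun x hx => ?_
      have hx1 : ψ x = 1 := (mem_filter.mp hx).2.2
      rw [re_char_add h2, hψv, hx1, add_assoc]
      split_ifs <;> simp
  rw [hdiff, abs_le, one_div_mul_eq_div, le_div_iff₀ hMpos, ← neg_div, div_le_iff₀ hMpos]
  have h1 := hup c
  have h3 := hup (c + v)
  rw [hsum] at hlow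
  rw [hcard] at hlow ⊢
  constructor <;> nlinarith

/-- If no colour gains density on `V ⊓ φ⁻¹ V ⊓ ker ψ` over `V`, for any character `ψ`, then there
are many monochromatic solutions of `φ x = y + z`. -/
lemma card_solutions_ge_of_level_le (h2 : ∀ x : G, x + x = 0) (φ : G ≃+ G) {r : ℕ} (hr : 0 < r)
    (χ : G → Fin r) (V : AddSubgroup G)
    (hlev : ∀ (ψ : AddChar G ℂ) (i : Fin r),
      level (2 * r ^ 3) {x | χ x = i} (V ⊓ V.comap (φ : G →+ G) ⊓ charKer ψ) ≤
        level (2 * r ^ 3) {x | χ x = i} V) :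
    (Nat.card V : ℝ) ^ 2 / (2 * r ^ 3) ≤
      #{t : G × G × G | χ t.1 = χ t.2.1 ∧ χ t.1 = χ t.2.2 ∧ φ t.1 = t.2.1 + t.2.2} := by
  set X := V.comap (φ : G →+ G) with hX
  have hVpos : 0 < Nat.card V := Nat.card_pos
  have hXV : Nat.card X = Nat.card V := by
    refine Nat.card_congr (φ.toEquiv.subtypeEquiv fun x => ?_)
    rfl
  obtain ⟨i, -, hi⟩ : ∃ i ∈ (univ : Finset (Fin r)),
      Nat.card V ≤ r * cosetCount {x | χ x = i} X 0 := by
    refine exists_le_of_sum_le ⟨⟨0, hr⟩, mem_univ _⟩ ?_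
    rw [sum_const, card_univ, Fintype.card_fin, smul_eq_mul, ← mul_sum]
    gcongr
    rw [← hXV, ← card_filter_mem, card_eq_sum_card_fiberwise (f := χ) (t := univ) (by simp)]
    refine (sum_congr rfl fun i _ => ?_).le
    rw [cosetCount, filter_filter]
    simp
  set S : Finset G := {x | χ x = i} with hS
  have hlevX : 2 * r ^ 2 ≤ level (2 * r ^ 3) S X := by
    refine le_trans ?_ (le_level _ _ _ 0)
    rw [hXV, Nat.le_div_iff_mul_le hVpos]
    calc 2 * r ^ 2 * Nat.card V ≤ 2 * r ^ 2 * (r * cosetCount S X 0) := by gcongr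
      _ = _ := by ring
  have hlevV : 2 * r ^ 2 ≤ level (2 * r ^ 3) S V :=
    hlevX.trans ((level_anti _ _ (inf_le_left.trans inf_le_right)).trans (hlev 0 i))
  obtain ⟨c, hc⟩ := exists_level_eq (2 * r ^ 3) S V
  set A : Finset G := {v | v ∈ V ∧ c + v ∈ S} with hA
  set B : Finset G := ({x | x ∈ X ∧ 0 + x ∈ S} : Finset G).map φ.toEquiv.toEmbedding with hB
  have hrpos : (0 : ℝ) < r := by exact_mod_cast hr
  have hAcard : (Nat.card V : ℝ) ≤ r * #A := by
    rw [hc, Nat.le_div_iff_mul_le hVpos] at hlevV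
    have h : Nat.card V ≤ r * cosetCount S V c := by
      refine Nat.le_of_mul_le_mul_left ?_ (show 0 < 2 * r ^ 2 by positivity)
      calc _ ≤ _ := hlevV
        _ = _ := by ring
    exact_mod_cast h
  have hBcard : (Nat.card V : ℝ) ≤ r * #B := by
    rw [hB, card_map]
    exact_mod_cast hi
  have key := card_add_mem_ge h2 V (A := A) (B := B) (η := 1 / (2 * r ^ 3 : ℕ))
    (fun a ha => (mem_filter.mp ha).2.1)
    (fun b hb => by
      obtain ⟨x, hx, rfl⟩ := mem_map.mp hb
      exact (mem_filter.mp hx).2.1)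
    (by positivity)
    (fun ψ hψ => by
      refine abs_charSum_coset_le h2 (by positivity) S V hψ ?_
      rw [← hc]
      exact (level_anti _ _ (inf_le_inf_right _ inf_le_left)).trans (hlev ψ i))
  have hinj : #{t ∈ A ×ˢ A ×ˢ B | t.1 + t.2.1 = t.2.2} ≤
      #{t : G × G × G | χ t.1 = χ t.2.1 ∧ χ t.1 = χ t.2.2 ∧ φ t.1 = t.2.1 + t.2.2} := by
    refine card_le_card_of_injOn (fun t => (φ.symm t.2.2, c + t.1, c + t.2.1)) ?_ ?_
    · rintro ⟨v, w, b⟩ ht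
      simp only [coe_filter, mem_product, Set.mem_ofPred_eq, hA, hB, hS, mem_filter, mem_univ,
        true_and, mem_map, zero_add] at ht ⊢
      obtain ⟨⟨⟨-, hv⟩, ⟨-, hw⟩, x, ⟨-, hx⟩, rfl⟩, hvw⟩ := ht
      have hφ : φ.symm (φ.toEquiv.toEmbedding x) = x := φ.symm_apply_apply x
      rw [hφ]
      refine ⟨hx.trans hv.symm, hx.trans hw.symm, ?_⟩
      rw [add_add_add_comm, h2, zero_add, hvw]
      rfl
    · rintro ⟨v, w, b⟩ - ⟨v', w', b'⟩ - h
      simpa [and_comm, and_assoc, and_left_comm] using h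
  refine le_trans ?_ (Nat.cast_le.mpr hinj)
  set N : ℝ := (#{t ∈ A ×ˢ A ×ˢ B | t.1 + t.2.1 = t.2.2} : ℝ)
  have hV : (0 : ℝ) < Nat.card V := by exact_mod_cast hVpos
  push_cast at key
  have hprod : (Nat.card V : ℝ) ^ 3 ≤ r ^ 3 * ((#A : ℝ) ^ 2 * #B) := by
    calc (Nat.card V : ℝ) ^ 3 = (Nat.card V : ℝ) ^ 2 * Nat.card V := by ring
      _ ≤ ((r : ℝ) * #A) ^ 2 * ((r : ℝ) * #B) := by gcongr
      _ = _ := by ring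
  have h3 : (r : ℝ) ^ 3 * (1 / (2 * r ^ 3) * (Nat.card V : ℝ) ^ 3) = Nat.card V ^ 3 / 2 := by
    field_simp
  have h4 := mul_le_mul_of_nonneg_left key (show (0 : ℝ) ≤ r ^ 3 by positivity)
  rw [mul_add, h3] at h4
  rw [div_le_iff₀ (by positivity)]
  refine le_of_mul_le_mul_left ?_ hV
  nlinarith

lemma exists_subgroup_le_sum_level (h2 : ∀ x : G, x + x = 0) (φ : G ≃+ G) {r : ℕ} (hr : 0 < r)
    (χ : G → Fin r) {D : ℝ}
    (hD : #{t : G × G × G | χ t.1 = χ t.2.1 ∧ χ t.1 = χ t.2.2 ∧ φ t.1 = t.2.1 + t.2.2} < D)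
    (K : ℕ) (hK : ∀ V : AddSubgroup G, V.index ≤ 2 ^ (K * (K + 1)) →
      D ≤ (Nat.card V : ℝ) ^ 2 / (2 * r ^ 3)) (k : ℕ) (hk : k ≤ K + 1) :
    ∃ U : AddSubgroup G, U.index ≤ 2 ^ k ∧
      k ≤ ∑ i, level (2 * r ^ 3) {x | χ x = i} (iterInf (φ : G →+ G) U k) := by
  induction k with
  | zero => exact ⟨⊤, by simp⟩
  | succ k ih =>
    obtain ⟨U, hU, hsum⟩ := ih (by omega)
    set V := iterInf (φ : G →+ G) U k with hV
    have hVindex : V.index ≤ 2 ^ (K * (K + 1)) := by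
      calc V.index ≤ U.index ^ (k + 1) := index_iterInf_le φ.surjective U k
        _ ≤ (2 ^ k) ^ (k + 1) := by gcongr
        _ = 2 ^ (k * (k + 1)) := by rw [pow_mul]
        _ ≤ 2 ^ (K * (K + 1)) := by
          have : k ≤ K := by omega
          gcongr
          norm_num
    obtain ⟨ψ, i, hi⟩ : ∃ (ψ : AddChar G ℂ) (i : Fin r),
        level (2 * r ^ 3) {x | χ x = i} V <
          level (2 * r ^ 3) {x | χ x = i} (V ⊓ V.comap (φ : G →+ G) ⊓ charKer ψ) := by
      by_contra! hcon
      have := card_solutions_ge_of_level_le h2 φ hr χ V hcon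
      linarith [hK V hVindex]
    refine ⟨U ⊓ charKer ψ, ?_, ?_⟩
    · calc (U ⊓ charKer ψ).index ≤ U.index * (charKer ψ).index := AddSubgroup.index_inf_le
        _ ≤ 2 ^ k * 2 := Nat.mul_le_mul hU (index_charKer_le_two h2 ψ)
        _ = 2 ^ (k + 1) := by ring
    · have hle : iterInf (φ : G →+ G) (U ⊓ charKer ψ) (k + 1) ≤
          V ⊓ V.comap (φ : G →+ G) ⊓ charKer ψ :=
        le_inf (le_inf
          ((iterInf_succ_le _ _ _).trans (iterInf_mono _ inf_le_left _))
          (inf_le_right.trans (AddSubgroup.comap_mono (iterInf_mono _ inf_le_left _))))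
          ((iterInf_le _ _ _).trans inf_le_right)
      refine Nat.succ_le_of_lt (hsum.trans_lt (sum_lt_sum (fun j _ => ?_) ⟨i, mem_univ i, ?_⟩))
      · exact level_anti _ _ (hle.trans (inf_le_left.trans inf_le_left))
      · exact hi.trans_le (level_anti _ _ hle)

/-- Every `r`-colouring of a finite elementary abelian `2`-group has many monochromatic solutions
of `φ x = y + z`, for any automorphism `φ`. -/
theorem card_solutions_ge (h2 : ∀ x : G, x + x = 0) (φ : G ≃+ G) {r : ℕ} (hr : 0 < r)
    (χ : G → Fin r) :
    (Fintype.card G : ℝ) ^ 2 / (4 ^ (2 * r ^ 4 * (2 * r ^ 4 + 1)) * (2 * r ^ 3)) ≤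
      #{t : G × G × G | χ t.1 = χ t.2.1 ∧ χ t.1 = χ t.2.2 ∧ φ t.1 = t.2.1 + t.2.2} := by
  by_contra! hlt
  obtain ⟨U, -, hU⟩ := exists_subgroup_le_sum_level h2 φ hr χ hlt (2 * r ^ 4) (fun V hV => by
    have h1 : (Fintype.card G : ℝ) ≤ 2 ^ (2 * r ^ 4 * (2 * r ^ 4 + 1)) * Nat.card V := by
      rw [← Nat.card_eq_fintype_card, ← V.index_mul_card]
      push_cast
      gcongr
      exact_mod_cast hV
    rw [← div_div]
    gcongr
    rw [div_le_iff₀ (by positivity)]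
    calc (Fintype.card G : ℝ) ^ 2 ≤ (2 ^ (2 * r ^ 4 * (2 * r ^ 4 + 1)) * Nat.card V) ^ 2 := by
          gcongr
      _ = _ := by
          rw [mul_pow, ← pow_mul, mul_comm _ 2, pow_mul]
          norm_num [mul_comm]) (2 * r ^ 4 + 1) le_rfl
  have hle := sum_le_sum fun (i : Fin r) (_ : i ∈ univ) =>
    level_le (2 * r ^ 3) {x | χ x = i} (iterInf (φ : G →+ G) U (2 * r ^ 4 + 1))
  rw [sum_const, card_univ, Fintype.card_fin, smul_eq_mul] at hle
  have : r * (2 * r ^ 3) = 2 * r ^ 4 := by ring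
  omega

end Increment

lemma exp_neg_pow_le {r : ℕ} (hr : 2 ≤ r) :
    Real.exp (-(r : ℝ) ^ (12 : ℝ)) ≤
      1 / (4 ^ (2 * r ^ 4 * (2 * r ^ 4 + 1)) * (2 * r ^ 3)) := by
  have hr' : (2 : ℝ) ≤ r := by exact_mod_cast hr
  rw [Real.exp_neg, ← one_div]
  have h4 : (4 : ℝ) ≤ Real.exp 2 := by
    have := Real.add_one_le_exp (1 : ℝ)
    have h : Real.exp 2 = Real.exp 1 * Real.exp 1 := by rw [← Real.exp_add]; norm_num
    nlinarith
  have h3 : (2 * r ^ 3 : ℝ) ≤ Real.exp (2 * r ^ 3) := by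
    linarith [Real.add_one_le_exp (2 * r ^ 3 : ℝ)]
  gcongr
  calc (4 : ℝ) ^ (2 * r ^ 4 * (2 * r ^ 4 + 1)) * (2 * r ^ 3)
      ≤ Real.exp 2 ^ (2 * r ^ 4 * (2 * r ^ 4 + 1)) * Real.exp (2 * r ^ 3) := by gcongr
    _ = Real.exp (2 * (2 * r ^ 4 * (2 * r ^ 4 + 1)) + 2 * r ^ 3) := by
        rw [← Real.exp_nat_mul, ← Real.exp_add]
        push_cast
        ring_nf
    _ ≤ Real.exp ((r : ℝ) ^ (12 : ℝ)) := by
        gcongr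
        rw [show (12 : ℝ) = ((12 : ℕ) : ℝ) by norm_num, Real.rpow_natCast]
        have h1 : (r : ℝ) ^ 4 ≤ r ^ 8 := pow_le_pow_right₀ (by linarith) (by norm_num)
        have h0 : (r : ℝ) ^ 3 ≤ r ^ 8 := pow_le_pow_right₀ (by linarith) (by norm_num)
        have h5 : (2 : ℝ) ^ 4 ≤ r ^ 4 := by gcongr
        have h6 : (0 : ℝ) ≤ r ^ 8 := by positivity
        nlinarith [mul_le_mul_of_nonneg_right h5 h6]

end SquareTriples

/-- There is an absolute constant `C > 0` such that for all `n, r ≥ 1` and any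
`r`-colouring `χ` of the finite field with `2^n` elements, the number of
monochromatic triples `(x, y, z)` with `x² = y + z` is at least
`exp(-r^C) · 4^n`. -/
theorem monochromatic_squares_char_two :
    ∃ C : ℝ, 0 < C ∧
      ∀ n r : ℕ, 1 ≤ n → 1 ≤ r →
        ∀ (F : Type) [Field F] [Fintype F] [DecidableEq F], Fintype.card F = 2 ^ n →
          ∀ χ : F → Fin r,
            Real.exp (-(r : ℝ) ^ C) * (4 : ℝ) ^ n ≤
              ((Finset.univ.filter fun t : F × F × F =>
                  χ t.1 = χ t.2.1 ∧ χ t.1 = χ t.2.2 ∧ t.1 ^ 2 = t.2.1 + t.2.2).card : ℝ) := by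
  refine ⟨12, by norm_num, ?_⟩
  intro n r _ hr F _ _ _ hcard χ
  have hsq : (4 : ℝ) ^ n = (Fintype.card F : ℝ) ^ 2 := by
    rw [hcard]
    push_cast
    rw [← pow_mul, mul_comm, pow_mul]
    norm_num
  rw [hsq]
  rcases hr.eq_or_lt with rfl | hr2
  · have hinj : Fintype.card (F × F) ≤ (Finset.univ.filter fun t : F × F × F =>
        χ t.1 = χ t.2.1 ∧ χ t.1 = χ t.2.2 ∧ t.1 ^ 2 = t.2.1 + t.2.2).card := by
      refine Finset.card_le_card_of_injOn (fun p => (p.1, p.2, p.1 ^ 2 - p.2)) ?_ ?_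
      · intro p _
        simp [eq_iff_true_of_subsingleton]
      · intro p _ q _ h
        simp only [Prod.mk.injEq] at h
        exact Prod.ext h.1 h.2.1
    rw [Fintype.card_prod] at hinj
    have hinj' : (Fintype.card F : ℝ) ^ 2 ≤ ((Finset.univ.filter fun t : F × F × F =>
        χ t.1 = χ t.2.1 ∧ χ t.1 = χ t.2.2 ∧ t.1 ^ 2 = t.2.1 + t.2.2).card : ℝ) := by
      rw [sq]
      exact_mod_cast hinj
    refine le_trans (mul_le_of_le_one_left (by positivity) ?_) hinj'
    exact Real.exp_le_one_iff.mpr (neg_nonpos.mpr (by positivity))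
  · have : Fact (Nat.Prime 2) := ⟨Nat.prime_two⟩
    have : CharP F 2 := charP_of_card_eq_prime_pow hcard
    have h := SquareTriples.card_solutions_ge (fun x : F => CharTwo.add_self_eq_zero x)
      (frobeniusEquiv F 2).toAddEquiv hr χ
    calc _ ≤ _ := mul_le_mul_of_nonneg_right (SquareTriples.exp_neg_pow_le hr2) (by positivity)
      _ = _ := one_div_mul_eq_div _ _
      _ ≤ _ := h
      _ = _ := by
        congr 2
        ext t
        simp [frobenius_def]
end
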